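/- arXiv:math/0405239 — 9 statements merged into one kernel-verified Lean document; each statement's English description precedes it below -/
import Mathlib

section
/- Let 1 ≤ p < ∞ and let (X,d) be a discrete metric space with property A_p. Then X admits a coarse embedding into ℓ_p(X × ℕ): there exist a map f : X → ℓ_p(X × ℕ) and monotone functions ρ₁, ρ₂ : ℝ₊ → ℝ₊ tending to infinity such that ρ₁(d(x,x')) ≤ ‖f(x) − f(x')‖_p ≤ ρ₂(d(x,x')) for all x, x' ∈ X. -/
open scoped ENNReal

/-- A metric space `X` has property `A_p`: there is a sequence of maps
`aⁿ : X → ℓ_p(X)` with `‖aⁿ_z‖_p = 1` and `aⁿ_z(y) ≥ 0`, such that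
(1) there is `R = R(n)` with `supp(aⁿ_z) ⊆ B_{R(n)}(z)` for all `z`, and
(2) for every `K > 0`, `sup_{d(z,w) ≤ K} ‖aⁿ_z − aⁿ_w‖_p → 0` as `n → ∞`. -/
def HasPropertyA (X : Type*) [MetricSpace X] (p : ℝ≥0∞) : Prop :=
  ∃ a : ℕ → X → lp (fun _ : X => ℝ) p,
    (∀ n z, ‖a n z‖ = 1) ∧
    (∀ (n : ℕ) (z y : X), 0 ≤ a n z y) ∧
    (∃ R : ℕ → ℝ, ∀ (n : ℕ) (z y : X), a n z y ≠ 0 → dist y z ≤ R n) ∧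
    (∀ K : ℝ, 0 < K → ∀ ε : ℝ, 0 < ε → ∃ N : ℕ, ∀ n ≥ N, ∀ z w : X,
      dist z w ≤ K → ‖a n z - a n w‖ ≤ ε)

open Filter

section SliceSum

variable {X : Type*} {p : ℝ≥0∞} {g : ℕ → lp (fun _ : X => ℝ) p}

/-- A sequence in `ℓ_p(X)` whose norms are `p`-summable is the family of slices
of an element of `ℓ_p(X × ℕ)`. -/
theorem hasSum_norm_rpow_of_slices (hp : 0 < p.toReal)
    (hg : Summable fun k => ‖g k‖ ^ p.toReal) :
    HasSum (fun q : X × ℕ => ‖g q.2 q.1‖ ^ p.toReal) (∑' k, ‖g k‖ ^ p.toReal) := by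
  have hk : ∀ k, HasSum (fun y => ‖g k y‖ ^ p.toReal) (‖g k‖ ^ p.toReal) :=
    fun k => lp.hasSum_norm hp (g k)
  have hs : Summable fun q : ℕ × X => ‖g q.1 q.2‖ ^ p.toReal := by
    refine (summable_prod_of_nonneg fun q => by positivity).2 ⟨fun k => (hk k).summable, ?_⟩
    simpa only [(hk _).tsum_eq] using hg
  have h := hs.hasSum
  rw [(h.prod_fiberwise hk).unique hg.hasSum] at h
  exact (Equiv.prodComm X ℕ).hasSum_iff.2 h

theorem memℓp_of_slices (hp : 0 < p.toReal) (hg : Summable fun k => ‖g k‖ ^ p.toReal) :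
    Memℓp (fun q : X × ℕ => g q.2 q.1) p :=
  memℓp_gen (hasSum_norm_rpow_of_slices hp hg).summable

theorem norm_rpow_eq_tsum_of_slices (hp : 0 < p.toReal)
    (F : lp (fun _ : X × ℕ => ℝ) p) (hF : ∀ q : X × ℕ, F q = g q.2 q.1)
    (hg : Summable fun k => ‖g k‖ ^ p.toReal) :
    ‖F‖ ^ p.toReal = ∑' k, ‖g k‖ ^ p.toReal := by
  rw [lp.norm_rpow_eq_tsum hp, ← (hasSum_norm_rpow_of_slices hp hg).tsum_eq]
  simp only [hF]

/-- The norm of a difference dominates the norm of the first term when the supports are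
disjoint. -/
theorem lp_norm_le_norm_sub_of_disjoint (hp : 0 < p.toReal) (u v : lp (fun _ : X => ℝ) p)
    (huv : ∀ y, u y = 0 ∨ v y = 0) : ‖u‖ ≤ ‖u - v‖ := by
  rw [← Real.rpow_le_rpow_iff (lp.norm_nonneg' _) (lp.norm_nonneg' _) hp,
    lp.norm_rpow_eq_tsum hp, lp.norm_rpow_eq_tsum hp]
  refine (lp.hasSum_norm hp u).summable.tsum_le_tsum (fun y => ?_)
    (lp.hasSum_norm hp (u - v)).summable
  refine Real.rpow_le_rpow (norm_nonneg _) ?_ hp.le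
  rcases huv y with h | h <;> simp [h]

end SliceSum

/-- For every sequence of thresholds there is a monotone unbounded integer-valued function `c`
such that `t` exceeds the first `c t` thresholds. -/
theorem exists_monotone_nat_control (T : ℕ → ℝ) :
    ∃ c : ℝ → ℕ, Monotone c ∧ Tendsto c atTop atTop ∧ ∀ t, ∀ k < c t, T k < t := by
  classical
  set S : ℕ → ℝ := fun m => m + ∑ i ∈ Finset.range m, |T i| with hS
  have hmS : ∀ m : ℕ, (m : ℝ) ≤ S m := fun m =>
    le_add_of_nonneg_right (Finset.sum_nonneg fun i _ => abs_nonneg _)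
  have hmono : Monotone fun t : ℝ => Nat.findGreatest (fun m => S m < t) ⌈t⌉₊ :=
    fun s t hst => Nat.findGreatest_mono (fun m hm => lt_of_lt_of_le hm hst) (Nat.ceil_mono hst)
  refine ⟨fun t => Nat.findGreatest (fun m => S m < t) ⌈t⌉₊, hmono, ?_, ?_⟩
  · refine tendsto_atTop.2 fun M => ?_
    filter_upwards [eventually_gt_atTop (S M)] with t ht
    refine Nat.le_findGreatest ?_ ht
    exact_mod_cast (hmS M).trans (ht.le.trans (Nat.le_ceil t))
  · intro t k hk
    have h : S (Nat.findGreatest (fun m => S m < t) ⌈t⌉₊) < t :=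
      Nat.findGreatest_of_ne_zero (P := fun m => S m < t) rfl (Nat.ne_zero_of_lt hk)
    refine lt_of_le_of_lt ?_ h
    calc T k ≤ |T k| := le_abs_self _
      _ ≤ ∑ i ∈ Finset.range (Nat.findGreatest (fun m => S m < t) ⌈t⌉₊), |T i| :=
        Finset.single_le_sum (f := fun i => |T i|) (fun i _ => abs_nonneg _)
          (Finset.mem_range.2 hk)
      _ ≤ _ := le_add_of_nonneg_left (Nat.cast_nonneg _)

/-- A sequence bounded by `2`, and by `2⁻ᵏ` from the index `d` on, is `p`-summable with a sum
controlled by `d`. -/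
theorem summable_rpow_and_tsum_le {p d : ℝ} (hp : 1 ≤ p) (hd : 0 ≤ d) {u : ℕ → ℝ}
    (h0 : ∀ k, 0 ≤ u k) (h2 : ∀ k, u k ≤ 2) (hu : ∀ k : ℕ, d ≤ k → u k ≤ (1 / 2) ^ k) :
    Summable (fun k => u k ^ p) ∧ ∑' k, u k ^ p ≤ 2 ^ p * (d + 1) + 2 := by
  have hp0 : 0 ≤ p := zero_le_one.trans hp
  set v : ℕ → ℝ := fun k => if k ∈ Finset.range ⌈d⌉₊ then 2 ^ p else 0 with hv
  have hvs : HasSum v (∑ k ∈ Finset.range ⌈d⌉₊, v k) :=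
    hasSum_sum_of_ne_finset_zero fun k hk => if_neg hk
  have hvd : ∑ k ∈ Finset.range ⌈d⌉₊, v k ≤ 2 ^ p * (d + 1) := by
    rw [Finset.sum_congr rfl fun k hk => if_pos hk, Finset.sum_const, Finset.card_range,
      nsmul_eq_mul, mul_comm]
    exact mul_le_mul_of_nonneg_left (Nat.ceil_lt_add_one hd).le (by positivity)
  have hsum := hvs.add hasSum_geometric_two
  have hle : ∀ k, u k ^ p ≤ v k + (1 / 2) ^ k := by
    intro k
    by_cases hk : k ∈ Finset.range ⌈d⌉₊
    · have := Real.rpow_le_rpow (h0 k) (h2 k) hp0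
      simp only [hv, if_pos hk]
      exact this.trans (le_add_of_nonneg_right (by positivity))
    · have hdk : d ≤ k := by simpa using hk
      simp only [hv, if_neg hk, zero_add]
      have h1 : u k ≤ 1 := (hu k hdk).trans (pow_le_one₀ (by norm_num) (by norm_num))
      exact (Real.rpow_le_self_of_le_one (h0 k) h1 hp).trans (hu k hdk)
  have hs : Summable fun k => u k ^ p :=
    Summable.of_nonneg_of_le (fun k => Real.rpow_nonneg (h0 k) p) hle hsum.summable
  refine ⟨hs, (hs.tsum_le_tsum hle hsum.summable).trans ?_⟩
  rw [hsum.tsum_eq]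
  linarith

/-- For `1 ≤ p < ∞`, a metric space with property `A_p` admits a coarse
embedding into `ℓ_p(X × ℕ)`. -/
theorem statement3 (X : Type*) [MetricSpace X] (p : ℝ) (hp : 1 ≤ p)
    (hA : HasPropertyA X (ENNReal.ofReal p)) :
    ∃ f : X → lp (fun _ : X × ℕ => ℝ) (ENNReal.ofReal p),
      ∃ ρ₁ ρ₂ : ℝ → ℝ, Monotone ρ₁ ∧ Monotone ρ₂ ∧
        Tendsto ρ₁ atTop atTop ∧ Tendsto ρ₂ atTop atTop ∧
        ∀ x x' : X, ρ₁ (dist x x') ≤ ‖f x - f x'‖ ∧ ‖f x - f x'‖ ≤ ρ₂ (dist x x') := by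
  have hp0 : 0 < p := zero_lt_one.trans_le hp
  have hpt : (ENNReal.ofReal p).toReal = p := ENNReal.toReal_ofReal hp0.le
  have hpt0 : 0 < (ENNReal.ofReal p).toReal := hpt.symm ▸ hp0
  have : Fact (1 ≤ ENNReal.ofReal p) := ⟨ENNReal.one_le_ofReal.2 hp⟩
  obtain ⟨a, ha1, -, ⟨R, hR⟩, hK⟩ := hA
  rcases isEmpty_or_nonempty X with hX | ⟨⟨x₀⟩⟩
  · exact ⟨fun _ => 0, id, id, monotone_id, monotone_id, tendsto_id, tendsto_id,
      fun x => isEmptyElim x⟩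
  choose N hN using fun k : ℕ => hK (k + 1) (by positivity) ((1 / 2) ^ k) (by positivity)
  set b : ℕ → X → lp (fun _ : X => ℝ) (ENNReal.ofReal p) := fun k => a (N k) with hb
  have hsum : ∀ x x' : X, Summable (fun k => ‖b k x - b k x'‖ ^ p) ∧
      ∑' k, ‖b k x - b k x'‖ ^ p ≤ 2 ^ p * (dist x x' + 1) + 2 := by
    refine fun x x' => summable_rpow_and_tsum_le hp dist_nonneg (fun k => norm_nonneg _)
      (fun k => ?_) fun k hk => hN k (N k) le_rfl x x' (hk.trans (by linarith))
    refine (norm_sub_le _ _).trans (le_of_eq ?_)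
    rw [hb, ha1, ha1]
    norm_num
  let f : X → lp (fun _ : X × ℕ => ℝ) (ENNReal.ofReal p) := fun x =>
    ⟨fun q => (b q.2 x - b q.2 x₀) q.1,
      memℓp_of_slices (g := fun k => b k x - b k x₀) hpt0 (by
        rw [hpt]; exact (hsum x x₀).1)⟩
  have hf : ∀ x x', ‖f x - f x'‖ ^ p = ∑' k, ‖b k x - b k x'‖ ^ p := by
    intro x x'
    have h := norm_rpow_eq_tsum_of_slices (g := fun k => b k x - b k x') hpt0 (f x - f x')
      (fun q => sub_sub_sub_cancel_right (b q.2 x q.1) (b q.2 x' q.1) (b q.2 x₀ q.1))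
      (by rw [hpt]; exact (hsum x x').1)
    rwa [hpt] at h
  obtain ⟨c, hc_mono, hc_tendsto, hc⟩ := exists_monotone_nat_control fun k => 2 * R (N k)
  have hfar : ∀ x x' k, 2 * R (N k) < dist x x' → 1 ≤ ‖b k x - b k x'‖ := by
    intro x x' k hk
    rw [← ha1 (N k) x]
    refine lp_norm_le_norm_sub_of_disjoint hpt0 _ _ fun y => ?_
    by_contra! h
    have h1 := hR (N k) x y h.1
    have h2 := hR (N k) x' y h.2
    linarith [dist_triangle_left x x' y]
  refine ⟨f, fun t => (c t : ℝ) ^ (1 / p), fun t => 2 ^ p * (max t 0 + 1) + 2, ?_, ?_, ?_, ?_, ?_⟩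
  · intro s t hst
    exact Real.rpow_le_rpow (Nat.cast_nonneg _) (by exact_mod_cast hc_mono hst) (by positivity)
  · intro s t hst
    dsimp only
    gcongr
  · exact (tendsto_rpow_atTop (by positivity)).comp (tendsto_natCast_atTop_atTop.comp hc_tendsto)
  · refine tendsto_atTop_mono (fun t => ?_) tendsto_id
    have h1 : (1 : ℝ) ≤ 2 ^ p := Real.one_le_rpow one_le_two hp0.le
    have h2 : t ≤ max t 0 := le_max_left _ _
    have h3 : 0 ≤ max t 0 := le_max_right _ _
    simp only [id]
    nlinarith
  · intro x x'
    constructor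
    · rw [one_div, Real.rpow_inv_le_iff_of_pos (Nat.cast_nonneg _) (norm_nonneg _) hp0, hf]
      calc (c (dist x x') : ℝ) = ∑ k ∈ Finset.range (c (dist x x')), (1 : ℝ) := by simp
        _ ≤ ∑ k ∈ Finset.range (c (dist x x')), ‖b k x - b k x'‖ ^ p :=
          Finset.sum_le_sum fun k hk => Real.one_le_rpow
            (hfar x x' k (hc _ k (Finset.mem_range.1 hk))) hp0.le
        _ ≤ _ := (hsum x x').1.sum_le_tsum _ fun k _ => Real.rpow_nonneg (norm_nonneg _) _
    · dsimp only
      rw [max_eq_left dist_nonneg]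
      rcases le_total ‖f x - f x'‖ 1 with h | h
      · have : 0 ≤ (2 : ℝ) ^ p * (dist x x' + 1) := by positivity
        linarith
      · exact (Real.self_le_rpow_of_one_le h hp).trans ((hf x x').le.trans (hsum x x').2)
end

section
/- If 1 ≤ p ≤ m < ∞ and a discrete metric space (X,d) has property A_p, then X has property A_m. -/
open scoped ENNReal

theorem Real.abs_rpow_sub_rpow_le {x y s : ℝ} (hx : 0 ≤ x) (hy : 0 ≤ y) (hs : 0 ≤ s)
    (hs1 : s ≤ 1) : |x ^ s - y ^ s| ≤ |x - y| ^ s := by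
  wlog h : y ≤ x generalizing x y
  · rw [abs_sub_comm, abs_sub_comm x]
    exact this hy hx (le_of_not_ge h)
  have hxy : 0 ≤ x - y := sub_nonneg.2 h
  rw [abs_of_nonneg hxy, abs_of_nonneg (sub_nonneg.2 (Real.rpow_le_rpow hy h hs))]
  have := Real.rpow_add_le_add_rpow hxy hy hs hs1
  rw [sub_add_cancel] at this
  linarith

/-- The Mazur map: if `f` is a nonnegative element of `ℓ_p`, then `f ^ (p / m)` is in `ℓ_m`. -/
theorem Memℓp.rpow_div {X : Type*} {p m : ℝ} (hp : 0 < p) (hm : 0 < m) {f : X → ℝ}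
    (hf : Memℓp f (ENNReal.ofReal p)) (hf0 : ∀ x, 0 ≤ f x) :
    Memℓp (fun x => f x ^ (p / m)) (ENNReal.ofReal m) := by
  have hpr : (ENNReal.ofReal p).toReal = p := ENNReal.toReal_ofReal hp.le
  have hmr : (ENNReal.ofReal m).toReal = m := ENNReal.toReal_ofReal hm.le
  rw [memℓp_gen_iff (by rwa [hmr])]
  rw [memℓp_gen_iff (by rwa [hpr])] at hf
  refine hf.congr fun x => ?_
  rw [hpr, hmr, Real.norm_of_nonneg (hf0 x), Real.norm_of_nonneg (Real.rpow_nonneg (hf0 x) _),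
    ← Real.rpow_mul (hf0 x), div_mul_cancel₀ _ hm.ne']

/-- If `1 ≤ p ≤ m < ∞` and a metric space `X` has property `A_p`,
then `X` has property `A_m`. -/
theorem statement4 (X : Type*) [MetricSpace X] (p m : ℝ) (hp : 1 ≤ p) (hpm : p ≤ m)
    (hA : HasPropertyA X (ENNReal.ofReal p)) : HasPropertyA X (ENNReal.ofReal m) := by
  obtain ⟨a, ha1, ha0, ⟨R, hR⟩, hlim⟩ := hA
  have hp0 : 0 < p := by linarith
  have hm0 : 0 < m := by linarith
  have hpr : (ENNReal.ofReal p).toReal = p := ENNReal.toReal_ofReal hp0.le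
  have hmr : (ENNReal.ofReal m).toReal = m := ENNReal.toReal_ofReal hm0.le
  have hp0' : 0 < (ENNReal.ofReal p).toReal := by rwa [hpr]
  have hm0' : 0 < (ENNReal.ofReal m).toReal := by rwa [hmr]
  have hs : 0 < p / m := div_pos hp0 hm0
  let b : ℕ → X → lp (fun _ : X => ℝ) (ENNReal.ofReal m) := fun n z =>
    ⟨fun y => a n z y ^ (p / m), (lp.memℓp (a n z)).rpow_div hp0 hm0 (ha0 n z)⟩
  have hb (n : ℕ) (z y : X) : b n z y = a n z y ^ (p / m) := rfl
  refine ⟨b, fun n z => ?_, fun n z y => Real.rpow_nonneg (ha0 n z y) _, ⟨R, fun n z y h => ?_⟩,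
    fun K hK ε hε => ?_⟩
  · have key : ‖b n z‖ ^ m = ‖a n z‖ ^ p := by
      have h1 := lp.norm_rpow_eq_tsum hm0' (b n z)
      have h2 := lp.norm_rpow_eq_tsum hp0' (a n z)
      rw [hmr] at h1
      rw [hpr] at h2
      rw [h1, h2]
      refine tsum_congr fun y => ?_
      rw [hb, Real.norm_of_nonneg (ha0 n z y),
        Real.norm_of_nonneg (Real.rpow_nonneg (ha0 n z y) _), ← Real.rpow_mul (ha0 n z y),
        div_mul_cancel₀ _ hm0.ne']
    rw [ha1, Real.one_rpow] at key
    exact (Real.rpow_left_inj (lp.norm_nonneg' _) zero_le_one hm0.ne').1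
      (key.trans (Real.one_rpow m).symm)
  · refine hR n z y fun h0 => h ?_
    rw [hb, h0, Real.zero_rpow hs.ne']
  · obtain ⟨N, hN⟩ := hlim K hK (ε ^ (m / p)) (Real.rpow_pos_of_pos hε _)
    refine ⟨N, fun n hn z w hzw => ?_⟩
    have key : ‖b n z - b n w‖ ^ m ≤ ‖a n z - a n w‖ ^ p := by
      have h1 := lp.hasSum_norm hm0' (b n z - b n w)
      have h2 := lp.hasSum_norm hp0' (a n z - a n w)
      rw [hmr] at h1
      rw [hpr] at h2
      refine hasSum_le (fun y => ?_) h1 h2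
      rw [lp.coeFn_sub, lp.coeFn_sub, Pi.sub_apply, Pi.sub_apply, hb, hb, Real.norm_eq_abs,
        Real.norm_eq_abs]
      calc |a n z y ^ (p / m) - a n w y ^ (p / m)| ^ m
          ≤ (|a n z y - a n w y| ^ (p / m)) ^ m :=
            Real.rpow_le_rpow (abs_nonneg _) (Real.abs_rpow_sub_rpow_le (ha0 n z y) (ha0 n w y)
              hs.le ((div_le_one hm0).2 hpm)) hm0.le
        _ = |a n z y - a n w y| ^ p := by
            rw [← Real.rpow_mul (abs_nonneg _), div_mul_cancel₀ _ hm0.ne']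
    refine (Real.rpow_le_rpow_iff (lp.norm_nonneg' _) hε.le hm0).1 (key.trans ?_)
    calc ‖a n z - a n w‖ ^ p ≤ (ε ^ (m / p)) ^ p :=
          Real.rpow_le_rpow (lp.norm_nonneg' _) (hN n hn z w hzw) hp0.le
      _ = ε ^ m := by rw [← Real.rpow_mul hε.le, div_mul_cancel₀ _ hp0.ne']
end

section
/- If p ≥ 2 is an integer and a discrete metric space (X,d) has property A_p, then X has property A_1. -/
open scoped ENNReal

/-- For a natural exponent, the `p`-th power of the `ℓ_p` norm is the sum of the `p`-th powers. -/
theorem lp.hasSum_norm_natPow {ι : Type*} {p : ℕ} (hp : p ≠ 0)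
    (f : lp (fun _ : ι => ℝ) (p : ℝ≥0∞)) :
    HasSum (fun i => ‖f i‖ ^ p) (‖f‖ ^ p) := by
  have h := lp.hasSum_norm (p := (p : ℝ≥0∞)) (by simpa using Nat.pos_of_ne_zero hp) f
  simpa using h

/-- A form of Young's inequality with a free parameter `t`. -/
theorem mul_pow_pred_le_add {p : ℕ} (hp : p ≠ 0) {u v t : ℝ} (hu : 0 ≤ u) (hv : 0 ≤ v)
    (ht : 0 < t) : u * v ^ (p - 1) ≤ u ^ p / t ^ (p - 1) + t * v ^ p := by
  obtain ⟨k, rfl⟩ := Nat.exists_eq_succ_of_ne_zero hp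
  simp only [Nat.succ_eq_add_one, Nat.add_sub_cancel]
  rcases le_total u (t * v) with h | h
  · calc u * v ^ k ≤ t * v * v ^ k := by gcongr
      _ = t * v ^ (k + 1) := by ring
      _ ≤ _ := le_add_of_nonneg_left (by positivity)
  · calc u * v ^ k = u * (t * v) ^ k / t ^ k := by rw [mul_pow]; field_simp
      _ ≤ u * u ^ k / t ^ k := by gcongr
      _ = u ^ (k + 1) / t ^ k := by ring
      _ ≤ _ := le_add_of_nonneg_right (by positivity)

theorem abs_pow_sub_pow_le_of_nonneg {p : ℕ} (hp : p ≠ 0) {x y t : ℝ} (hx : 0 ≤ x) (hy : 0 ≤ y)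
    (ht : 0 < t) :
    |x ^ p - y ^ p| ≤ p * (|x - y| ^ p / t ^ (p - 1) + t * |x + y| ^ p) := by
  calc |x ^ p - y ^ p| ≤ |x - y| * p * max |x| |y| ^ (p - 1) := abs_pow_sub_pow_le x y p
    _ ≤ |x - y| * p * |x + y| ^ (p - 1) := by
        gcongr
        rw [abs_of_nonneg hx, abs_of_nonneg hy, abs_of_nonneg (add_nonneg hx hy)]
        exact max_le (by linarith) (by linarith)
    _ = p * (|x - y| * |x + y| ^ (p - 1)) := by ring
    _ ≤ _ := by
        gcongr
        exact mul_pow_pred_le_add hp (abs_nonneg _) (abs_nonneg _) ht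

/-- The Mazur map `f ↦ f ^ p` from `ℓ_p` to `ℓ_1`, for a natural exponent. -/
noncomputable def lp.natPow {ι : Type*} {p : ℕ} (hp : p ≠ 0)
    (f : lp (fun _ : ι => ℝ) (p : ℝ≥0∞)) : lp (fun _ : ι => ℝ) 1 :=
  ⟨fun i => f i ^ p, memℓp_gen (by simpa using (lp.hasSum_norm_natPow hp f).summable)⟩

theorem lp.natPow_apply {ι : Type*} {p : ℕ} (hp : p ≠ 0)
    (f : lp (fun _ : ι => ℝ) (p : ℝ≥0∞)) (i : ι) : lp.natPow hp f i = f i ^ p := rfl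

theorem lp.hasSum_norm_one {ι : Type*} (f : lp (fun _ : ι => ℝ) 1) :
    HasSum (fun i => ‖f i‖) ‖f‖ := by
  simpa using lp.hasSum_norm (p := 1) (by simp) f

theorem lp.norm_natPow {ι : Type*} {p : ℕ} (hp : p ≠ 0)
    (f : lp (fun _ : ι => ℝ) (p : ℝ≥0∞)) : ‖lp.natPow hp f‖ = ‖f‖ ^ p := by
  refine (lp.hasSum_norm_one _).unique ?_
  simpa [lp.natPow_apply] using lp.hasSum_norm_natPow hp f

/-- The Mazur map is Lipschitz on the positive part of the unit ball. -/
theorem lp.norm_natPow_sub_le {ι : Type*} {p : ℕ} (hp : p ≠ 0)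
    {f g : lp (fun _ : ι => ℝ) (p : ℝ≥0∞)} (hf : ∀ i, 0 ≤ f i) (hg : ∀ i, 0 ≤ g i)
    (hf1 : ‖f‖ ≤ 1) (hg1 : ‖g‖ ≤ 1) {t : ℝ} (ht : 0 < t) (hfg : ‖f - g‖ ≤ t) :
    ‖lp.natPow hp f - lp.natPow hp g‖ ≤ p * (1 + 2 ^ p) * t := by
  have : Fact ((1 : ℝ≥0∞) ≤ p) := ⟨by exact_mod_cast Nat.one_le_iff_ne_zero.mpr hp⟩
  have hsum := (((lp.hasSum_norm_natPow hp (f - g)).div_const (t ^ (p - 1))).add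
    ((lp.hasSum_norm_natPow hp (f + g)).mul_left t)).mul_left (p : ℝ)
  have hadd : ‖f + g‖ ≤ 2 := (norm_add_le f g).trans (by linarith)
  calc ‖lp.natPow hp f - lp.natPow hp g‖
      ≤ p * (‖f - g‖ ^ p / t ^ (p - 1) + t * ‖f + g‖ ^ p) :=
        hasSum_le (fun i => abs_pow_sub_pow_le_of_nonneg hp (hf i) (hg i) ht)
          (lp.hasSum_norm_one _) hsum
    _ ≤ p * (t ^ p / t ^ (p - 1) + t * 2 ^ p) := by gcongr
    _ = p * (1 + 2 ^ p) * t := by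
        obtain ⟨k, rfl⟩ := Nat.exists_eq_succ_of_ne_zero hp
        simp only [Nat.succ_eq_add_one, Nat.add_sub_cancel]
        field_simp
        ring

/-- If `p ≥ 2` is an integer and a metric space `X` has property `A_p`,
then `X` has property `A_1`. -/
theorem statement5 (X : Type*) [MetricSpace X] (p : ℕ) (hp : 2 ≤ p)
    (hA : HasPropertyA X (p : ℝ≥0∞)) : HasPropertyA X 1 := by
  have hp0 : p ≠ 0 := by omega
  obtain ⟨a, hnorm, hnonneg, ⟨R, hR⟩, hlim⟩ := hA
  refine ⟨fun n z => lp.natPow hp0 (a n z), fun n z => ?_, fun n z y => ?_,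
    ⟨R, fun n z y h => ?_⟩, fun K hK ε hε => ?_⟩
  · rw [lp.norm_natPow, hnorm, one_pow]
  · exact pow_nonneg (hnonneg n z y) p
  · exact hR n z y ((pow_ne_zero_iff hp0).mp h)
  · have hC : (0 : ℝ) < p * (1 + 2 ^ p) := by positivity
    obtain ⟨N, hN⟩ := hlim K hK (ε / (p * (1 + 2 ^ p))) (by positivity)
    refine ⟨N, fun n hn z w hzw => ?_⟩
    calc _ ≤ p * (1 + 2 ^ p) * (ε / (p * (1 + 2 ^ p))) :=
          lp.norm_natPow_sub_le hp0 (hnonneg n z) (hnonneg n w) (hnorm n z).le (hnorm n w).le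
            (by positivity) (hN n hn z w hzw)
      _ = ε := mul_div_cancel₀ ε hC.ne'
end

section
/- For every real p with 1 ≤ p < ∞, a discrete metric space (X,d) has property A_1 if and only if X has property A_p. -/
open scoped ENNReal

theorem Real.abs_sub_rpow_le_abs_rpow_sub_rpow {p u v : ℝ} (hp : 1 ≤ p) (hu : 0 ≤ u)
    (hv : 0 ≤ v) : |u - v| ^ p ≤ |u ^ p - v ^ p| := by
  wlog h : v ≤ u generalizing u v
  · rw [abs_sub_comm u, abs_sub_comm (u ^ p)]
    exact this hv hu (le_of_not_ge h)
  have h₁ := Real.add_rpow_le_rpow_add (sub_nonneg.2 h) hv hp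
  rw [sub_add_cancel] at h₁
  rw [abs_of_nonneg (sub_nonneg.2 h)]
  exact le_trans (by linarith) (le_abs_self _)

theorem Real.rpow_sub_rpow_le {p s t : ℝ} (hp : 1 ≤ p) (ht : 0 ≤ t) (hts : t ≤ s) :
    s ^ p - t ^ p ≤ p * ((s - t) * s ^ (p - 1)) := by
  rcases (ht.trans hts).eq_or_lt with rfl | hs
  · obtain rfl : t = 0 := le_antisymm hts ht
    simp
  have h₁ := one_add_mul_self_le_rpow_one_add (s := t / s - 1) (by
    have := div_nonneg ht hs.le
    linarith) hp
  rw [add_sub_cancel, Real.div_rpow ht hs.le, le_div_iff₀ (Real.rpow_pos_of_pos hs p)] at h₁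
  have h₂ : s ^ p = s * s ^ (p - 1) := by
    rw [← Real.rpow_one_add' hs.le (by linarith)]
    congr 1
    ring
  have h₃ : (1 + p * (t / s - 1)) * s ^ p = s ^ p - p * ((s - t) * s ^ (p - 1)) := by
    rw [h₂]
    field_simp
    ring
  linarith

theorem Real.abs_rpow_sub_rpow_le_s6 {p s t η : ℝ} (hp : 1 ≤ p) (hs : 0 ≤ s) (ht : 0 ≤ t)
    (hη : 0 < η) :
    |s ^ p - t ^ p| ≤ p * (η * (s ^ p + t ^ p) + η ^ (1 - p) * |s - t| ^ p) := by
  wlog h : t ≤ s generalizing s t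
  · rw [abs_sub_comm s, abs_sub_comm (s ^ p), add_comm (s ^ p)]
    exact this ht hs (le_of_not_ge h)
  have hd : 0 ≤ s - t := sub_nonneg.2 h
  rw [abs_of_nonneg (sub_nonneg.2 (Real.rpow_le_rpow ht h (by linarith))), abs_of_nonneg hd]
  refine (Real.rpow_sub_rpow_le hp ht h).trans (mul_le_mul_of_nonneg_left ?_ (by linarith))
  have key {x : ℝ} (hx : 0 ≤ x) : x * x ^ (p - 1) = x ^ p := by
    rw [← Real.rpow_one_add' hx (by linarith)]
    congr 1
    ring
  have hsp := Real.rpow_nonneg hs p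
  have htp := Real.rpow_nonneg ht p
  rcases le_total (s - t) (η * s) with h₁ | h₁
  · calc (s - t) * s ^ (p - 1) ≤ η * s * s ^ (p - 1) := by gcongr
      _ = η * s ^ p := by rw [mul_assoc, key hs]
      _ ≤ η * (s ^ p + t ^ p) := by gcongr; linarith
      _ ≤ _ := le_add_of_nonneg_right (by positivity)
  · have h₂ : s ≤ (s - t) / η := by rwa [le_div_iff₀ hη, mul_comm]
    calc (s - t) * s ^ (p - 1) ≤ (s - t) * ((s - t) / η) ^ (p - 1) := by gcongr
      _ = η ^ (1 - p) * (s - t) ^ p := by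
        rw [Real.div_rpow hd hη.le, ← key hd, ← neg_sub p 1, Real.rpow_neg hη.le]
        ring
      _ ≤ _ := le_add_of_nonneg_left (by positivity)

/-- Property `A_p` expressed through kernels on `X × X` and sums of `p`-th powers. -/
theorem hasPropertyA_ofReal_iff (X : Type*) [MetricSpace X] {p : ℝ} (hp : 1 ≤ p) :
    HasPropertyA X (ENNReal.ofReal p) ↔ ∃ a : ℕ → X → X → ℝ,
      (∀ n z, HasSum (fun y => a n z y ^ p) 1) ∧
      (∀ n z y, 0 ≤ a n z y) ∧
      (∃ R : ℕ → ℝ, ∀ n z y, a n z y ≠ 0 → dist y z ≤ R n) ∧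
      (∀ K : ℝ, 0 < K → ∀ ε : ℝ, 0 < ε → ∃ N : ℕ, ∀ n ≥ N, ∀ z w : X,
        dist z w ≤ K → ∃ c ≤ ε, HasSum (fun y => |a n z y - a n w y| ^ p) c) := by
  have hp₀ : 0 < p := by linarith
  have hpr : (ENNReal.ofReal p).toReal = p := ENNReal.toReal_ofReal hp₀.le
  have hsum (f : lp (fun _ : X => ℝ) (ENNReal.ofReal p)) :
      HasSum (fun y => |f y| ^ p) (‖f‖ ^ p) := by
    simpa only [hpr, Real.norm_eq_abs] using lp.hasSum_norm (by rwa [hpr]) f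
  have : Fact (1 ≤ ENNReal.ofReal p) := ⟨by simpa using hp⟩
  constructor
  · rintro ⟨a, h1, h0, hR, hlim⟩
    refine ⟨fun n z y => a n z y, fun n z => ?_, h0, hR, fun K hK ε hε => ?_⟩
    · simpa only [h1, Real.one_rpow, abs_of_nonneg (h0 n z _)] using hsum (a n z)
    · obtain ⟨N, hN⟩ := hlim K hK (ε ^ p⁻¹) (by positivity)
      refine ⟨N, fun n hn z w hzw => ⟨‖a n z - a n w‖ ^ p, ?_, hsum (a n z - a n w)⟩⟩
      exact (Real.le_rpow_inv_iff_of_pos (norm_nonneg _) hε.le hp₀).1 (hN n hn z w hzw)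
  · rintro ⟨a, h1, h0, hR, hlim⟩
    have hmem (n : ℕ) (z : X) : Memℓp (a n z) (ENNReal.ofReal p) := by
      refine memℓp_gen ?_
      simpa only [hpr, Real.norm_eq_abs, abs_of_nonneg (h0 n z _)] using (h1 n z).summable
    let b (n : ℕ) (z : X) : lp (fun _ : X => ℝ) (ENNReal.ofReal p) := ⟨a n z, hmem n z⟩
    refine ⟨b, fun n z => ?_, h0, hR, fun K hK ε hε => ?_⟩
    · have h := hsum (b n z)
      have h' : HasSum (fun y => |b n z y| ^ p) 1 := by
        simpa only [abs_of_nonneg (h0 n z _), b] using h1 n z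
      exact (Real.rpow_left_inj (norm_nonneg _) zero_le_one hp₀.ne').1
        ((h.unique h').trans (Real.one_rpow p).symm)
    · obtain ⟨N, hN⟩ := hlim K hK (ε ^ p) (by positivity)
      refine ⟨N, fun n hn z w hzw => ?_⟩
      obtain ⟨c, hc, hs⟩ := hN n hn z w hzw
      have h : ‖b n z - b n w‖ ^ p = c := (hsum (b n z - b n w)).unique hs
      exact (Real.rpow_le_rpow_iff (norm_nonneg _) hε.le hp₀).1 (h.trans_le hc)

/-- For every real `p` with `1 ≤ p < ∞`, a metric space has property `A_1`
if and only if it has property `A_p`. -/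
theorem statement6 (X : Type*) [MetricSpace X] (p : ℝ) (hp : 1 ≤ p) :
    HasPropertyA X 1 ↔ HasPropertyA X (ENNReal.ofReal p) := by
  have hp₀ : 0 < p := by linarith
  rw [← ENNReal.ofReal_one, hasPropertyA_ofReal_iff X le_rfl, hasPropertyA_ofReal_iff X hp]
  simp only [Real.rpow_one]
  constructor
  · rintro ⟨a, h1, h0, ⟨R, hR⟩, hlim⟩
    have hpow (n : ℕ) (z y : X) : (a n z y ^ p⁻¹) ^ p = a n z y :=
      Real.rpow_inv_rpow (h0 n z y) hp₀.ne'
    refine ⟨fun n z y => a n z y ^ p⁻¹, fun n z => ?_, fun n z y => Real.rpow_nonneg (h0 n z y) _,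
      ⟨R, fun n z y h => hR n z y fun h' => h ?_⟩, fun K hK ε hε => ?_⟩
    · simpa only [hpow] using h1 n z
    · simp [h', hp₀.ne']
    · obtain ⟨N, hN⟩ := hlim K hK ε hε
      refine ⟨N, fun n hn z w hzw => ?_⟩
      obtain ⟨c, hc, hs⟩ := hN n hn z w hzw
      have hle (y : X) : |a n z y ^ p⁻¹ - a n w y ^ p⁻¹| ^ p ≤ |a n z y - a n w y| := by
        simpa only [hpow] using Real.abs_sub_rpow_le_abs_rpow_sub_rpow hp
          (Real.rpow_nonneg (h0 n z y) p⁻¹) (Real.rpow_nonneg (h0 n w y) p⁻¹)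
      have hsb := Summable.of_nonneg_of_le (fun y => by positivity) hle hs.summable
      exact ⟨_, (hasSum_le hle hsb.hasSum hs).trans hc, hsb.hasSum⟩
  · rintro ⟨a, h1, h0, ⟨R, hR⟩, hlim⟩
    refine ⟨fun n z y => a n z y ^ p, h1, fun n z y => Real.rpow_nonneg (h0 n z y) _,
      ⟨R, fun n z y h => hR n z y fun h' => h ?_⟩, fun K hK ε hε => ?_⟩
    · simp [h', hp₀.ne']
    · obtain ⟨η, hη, hηε⟩ : ∃ η : ℝ, 0 < η ∧ p * (3 * η) = ε :=
        ⟨ε / (3 * p), by positivity, by field_simp⟩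
      obtain ⟨N, hN⟩ := hlim K hK (η ^ p) (by positivity)
      refine ⟨N, fun n hn z w hzw => ?_⟩
      obtain ⟨c, hc, hs⟩ := hN n hn z w hzw
      have hle (y : X) := Real.abs_rpow_sub_rpow_le_s6 hp (h0 n z y) (h0 n w y) hη
      have hbound := ((((h1 n z).add (h1 n w)).mul_left η).add
        (hs.mul_left (η ^ (1 - p)))).mul_left p
      have hsb := Summable.of_nonneg_of_le (fun y => abs_nonneg _) hle hbound.summable
      refine ⟨_, (hasSum_le hle hsb.hasSum hbound).trans ?_, hsb.hasSum⟩
      have h : η ^ (1 - p) * c ≤ η := by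
        calc η ^ (1 - p) * c ≤ η ^ (1 - p) * η ^ p := by gcongr
          _ = η := by rw [← Real.rpow_add hη, sub_add_cancel, Real.rpow_one]
      rw [← hηε]
      gcongr
      linarith
end

section
/- Let p ≥ 2 be an integer and let q satisfy 1/p + 1/q = 1. Let X be a countable set and let b, c ∈ ℓ_p(X) be nonnegative with ‖b‖_p = ‖c‖_p = 1. Denote by b^p, c^p ∈ ℓ_1(X) their pointwise p-th powers. Then ‖b^p − c^p‖_1 ≤ 2^{1/q} · p · ‖b − c‖_p. -/
open scoped ENNReal

theorem lp.hasSum_abs_pow {X : Type*} {p : ℕ} (hp : 0 < p)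
    (f : lp (fun _ : X => ℝ) (p : ℝ≥0∞)) : HasSum (fun x => |f x| ^ p) (‖f‖ ^ p) := by
  have h := lp.hasSum_norm (p := (p : ℝ≥0∞)) (by simpa using hp) f
  simpa using h

/-- For an integer `p ≥ 2` and `q` with `1/p + 1/q = 1`: if `b, c ∈ ℓ_p(X)`
are nonnegative with `‖b‖_p = ‖c‖_p = 1`, then the pointwise `p`-th powers
`b^p, c^p ∈ ℓ_1(X)` satisfy `‖b^p − c^p‖_1 ≤ 2^{1/q} · p · ‖b − c‖_p`. -/
theorem statement7 (X : Type*) [Countable X] (p : ℕ) (hp : 2 ≤ p) (q : ℝ)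
    (hq : 1 / (p : ℝ) + 1 / q = 1)
    (b c : lp (fun _ : X => ℝ) (p : ℝ≥0∞))
    (hb : ∀ x, 0 ≤ b x) (hc : ∀ x, 0 ≤ c x)
    (hnb : ‖b‖ = 1) (hnc : ‖c‖ = 1)
    (bp cp : lp (fun _ : X => ℝ) 1)
    (hbp : ∀ x, bp x = (b x) ^ p) (hcp : ∀ x, cp x = (c x) ^ p) :
    ‖bp - cp‖ ≤ (2 : ℝ) ^ (1 / q) * p * ‖b - c‖ := by
  have hp0 : 0 < p := by omega
  have hp1 : (1 : ℝ) < p := by exact_mod_cast hp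
  have hpq : (p : ℝ).HolderConjugate q :=
    Real.holderConjugate_iff.2 ⟨hp1, by simpa using hq⟩
  have hB : HasSum (fun x => b x ^ p) 1 := by
    simpa [hnb, abs_of_nonneg (hb _)] using lp.hasSum_abs_pow hp0 b
  have hC : HasSum (fun x => c x ^ p) 1 := by
    simpa [hnc, abs_of_nonneg (hc _)] using lp.hasSum_abs_pow hp0 c
  have hD : HasSum (fun x => |b x - c x| ^ (p : ℝ)) (‖b - c‖ ^ p) := by
    simpa using lp.hasSum_abs_pow hp0 (b - c)
  have hN : HasSum (fun x => |b x ^ p - c x ^ p|) ‖bp - cp‖ := by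
    simpa [hbp, hcp] using lp.hasSum_norm (p := 1) (by simp) (bp - cp)
  have hmax : ∀ x, 0 ≤ max (b x) (c x) := fun x => le_max_of_le_left (hb x)
  have hexp (x : X) : (max (b x) (c x) ^ (p - 1)) ^ q = max (b x) (c x) ^ p := by
    rw [← Real.rpow_natCast, ← Real.rpow_mul (hmax x), Nat.cast_sub (by omega), Nat.cast_one,
      hpq.sub_one_mul_conj, Real.rpow_natCast]
  have hmaxle (x : X) : (max (b x) (c x) ^ (p - 1)) ^ q ≤ b x ^ p + c x ^ p := by
    rw [hexp]
    rcases max_choice (b x) (c x) with h | h <;> rw [h]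
    · exact le_add_of_nonneg_right (pow_nonneg (hc x) p)
    · exact le_add_of_nonneg_left (pow_nonneg (hb x) p)
  have hM : Summable (fun x => (max (b x) (c x) ^ (p - 1)) ^ q) :=
    .of_nonneg_of_le (fun x => Real.rpow_nonneg (pow_nonneg (hmax x) _) _) hmaxle
      (hB.add hC).summable
  have hMle : ∑' x, (max (b x) (c x) ^ (p - 1)) ^ q ≤ 2 := by
    have h := hasSum_le hmaxle hM.hasSum (hB.add hC)
    linarith
  obtain ⟨hS, hHolder⟩ := Real.summable_and_inner_le_Lp_mul_Lq_tsum_of_nonneg hpq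
    (fun x => abs_nonneg (b x - c x)) (fun x => pow_nonneg (hmax x) (p - 1)) hD.summable hM
  have hroot : (∑' x, |b x - c x| ^ (p : ℝ)) ^ (1 / (p : ℝ)) = ‖b - c‖ := by
    rw [hD.tsum_eq, one_div, Real.pow_rpow_inv_natCast (lp.norm_nonneg' _) hp0.ne']
  rw [hroot] at hHolder
  have hpoint (x : X) : |b x ^ p - c x ^ p| ≤
      p * (|b x - c x| * max (b x) (c x) ^ (p - 1)) := by
    have h := abs_pow_sub_pow_le (b x) (c x) p
    rw [abs_of_nonneg (hb x), abs_of_nonneg (hc x)] at h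
    linarith
  calc ‖bp - cp‖ ≤ p * ∑' x, |b x - c x| * max (b x) (c x) ^ (p - 1) :=
        hasSum_le hpoint hN (hS.hasSum.mul_left _)
    _ ≤ p * (‖b - c‖ * (∑' x, (max (b x) (c x) ^ (p - 1)) ^ q) ^ (1 / q)) := by gcongr
    _ ≤ p * (‖b - c‖ * 2 ^ (1 / q)) := by
        have := hpq.symm.pos
        gcongr
        · exact lp.norm_nonneg' _
        · exact tsum_nonneg fun x => Real.rpow_nonneg (pow_nonneg (hmax x) _) _
    _ = 2 ^ (1 / q) * p * ‖b - c‖ := by ring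
end

section
/- Suppose a discrete metric space (X, ρ) and a real number p > 1 satisfy lim_{λ→∞} ad_X(λ)/λ^p = 0. Then X has property A_p. -/
/-- `𝒰` is a cover of `X`. -/
def IsCover {X : Type*} (𝒰 : Set (Set X)) : Prop := ∀ x : X, ∃ U ∈ 𝒰, x ∈ U

/-- `lam` is a Lebesgue number for the cover `𝒰` with respect to the distance
function `d`: every set of diameter at most `lam` is contained in a member of `𝒰`.
The condition `L(𝒰) ≥ lam` is formalized as this predicate. -/
def IsLebesgueNumber {X : Type*} (d : X → X → ℝ) (𝒰 : Set (Set X)) (lam : ℝ) : Prop :=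
  ∀ A : Set X, (∀ x ∈ A, ∀ y ∈ A, d x y ≤ lam) → ∃ U ∈ 𝒰, A ⊆ U

/-- The multiplicity of the family `𝒰` is at most `n`: any finitely many distinct
members of `𝒰` with a common point number at most `n`. -/
def MultiplicityLE {X : Type*} (𝒰 : Set (Set X)) (n : ℕ) : Prop :=
  ∀ F : Finset (Set X), ↑F ⊆ 𝒰 → (⋂₀ (F : Set (Set X))).Nonempty → F.card ≤ n

/-- All members of the family `𝒰` have diameter at most `D` w.r.t. `d`. -/
def FamilyDiamLE {X : Type*} (d : X → X → ℝ) (𝒰 : Set (Set X)) (D : ℝ) : Prop :=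
  ∀ U ∈ 𝒰, ∀ x ∈ U, ∀ y ∈ U, d x y ≤ D

/-- The family `𝒰` is uniformly bounded w.r.t. `d`. -/
def UniformlyBounded {X : Type*} (d : X → X → ℝ) (𝒰 : Set (Set X)) : Prop :=
  ∃ D : ℝ, FamilyDiamLE d 𝒰 D

/-- `ad_X(lam) ≤ c` (for a real bound `c`): there is a uniformly bounded cover `𝒰`
with Lebesgue number at least `lam` whose multiplicity, minus one, is at most `c`. -/
def adLE {X : Type*} (d : X → X → ℝ) (lam : ℝ) (c : ℝ) : Prop :=
  ∃ 𝒰 : Set (Set X), IsCover 𝒰 ∧ UniformlyBounded d 𝒰 ∧ IsLebesgueNumber d 𝒰 lam ∧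
    ∀ F : Finset (Set X), ↑F ⊆ 𝒰 → (⋂₀ (F : Set (Set X))).Nonempty → (F.card : ℝ) ≤ c + 1

/-- `asdim (X,d) ≤ n`: for every `r` there are `n+1` uniformly bounded, `r`-disjoint
families of subsets of `X` whose union covers `X`. -/
def AsdimLE {X : Type*} (d : X → X → ℝ) (n : ℕ) : Prop :=
  ∀ r : ℝ, ∃ 𝒰 : Fin (n + 1) → Set (Set X),
    (∀ i, UniformlyBounded d (𝒰 i)) ∧
    (∀ i, ∀ U ∈ 𝒰 i, ∀ V ∈ 𝒰 i, U ≠ V → ∀ x ∈ U, ∀ y ∈ V, r ≤ d x y) ∧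
    IsCover (⋃ i, 𝒰 i)

/-- The word norm of `g` with respect to the generating set `S`. -/
noncomputable def wordNorm {G : Type*} [Group G] (S : Set G) (g : G) : ℕ :=
  sInf {n : ℕ | ∃ l : List G, (∀ s ∈ l, s ∈ S) ∧ l.prod = g ∧ l.length = n}

/-- The (left-invariant) word metric on `G` determined by the generating set `S`. -/
noncomputable def wordDist {G : Type*} [Group G] (S : Set G) (g h : G) : ℝ :=
  (wordNorm S (g⁻¹ * h) : ℝ)

open scoped ENNReal
open Filter

/-- A uniformly bounded cover can be re-indexed by the points of the space, without increasing
its multiplicity, so that the set with index `y` stays close to `y`. -/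
theorem adLE.exists_indexed_cover {X : Type*} [MetricSpace X] {r : ℝ} {k : ℕ}
    (h : adLE (dist : X → X → ℝ) (2 * r) k) :
    ∃ V : X → Set X, (∃ R : ℝ, ∀ y, ∀ z ∈ V y, dist y z ≤ R) ∧
      (∀ z, 0 ≤ r → ∃ y, Metric.closedBall z r ⊆ V y) ∧
      ∀ z, ∃ S : Finset X, S.card ≤ k + 1 ∧ ∀ y, z ∈ V y → y ∈ S := by
  classical
  obtain ⟨𝒰, -, ⟨R, hR⟩, hL, hm⟩ := h
  refine ⟨fun y => {x | ∃ U ∈ 𝒰, x ∈ U ∧ ∃ hU : U.Nonempty, hU.some = y}, ⟨R, ?_⟩, ?_, ?_⟩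
  · rintro y z ⟨U, hU, hz, hne, rfl⟩
    exact hR U hU _ hne.some_mem _ hz
  · intro z hr
    obtain ⟨U, hU, hsub⟩ := hL (Metric.closedBall z r) fun x hx y hy => by
      have := dist_triangle_right x y z
      rw [Metric.mem_closedBall] at hx hy
      linarith
    have hne : U.Nonempty := ⟨z, hsub (Metric.mem_closedBall_self hr)⟩
    exact ⟨hne.some, fun x hx => ⟨U, hU, hsub hx, hne, rfl⟩⟩
  · intro z
    set T : Set X := {y | ∃ U ∈ 𝒰, z ∈ U ∧ ∃ hU : U.Nonempty, hU.some = y} with hT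
    have hcard : ∀ F : Finset X, ↑F ⊆ T → F.card ≤ k + 1 := by
      intro F hF
      choose! U hU hz hne hy using hF
      have hinj : Set.InjOn U F := fun a ha b hb hab => by
        rw [← hy ha, ← hy hb]
        congr
      have := hm (F.image U) (by simpa [Set.subset_def] using fun a ha => hU ha)
        ⟨z, by simpa using fun a ha => hz ha⟩
      rw [Finset.card_image_of_injOn hinj] at this
      exact_mod_cast this
    have hfin : T.Finite := by
      by_contra hinf
      obtain ⟨F, hF, hc⟩ := Set.Infinite.exists_subset_card_eq hinf (k + 2)
      have := hcard F hF
      omega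
    exact ⟨hfin.toFinset, hcard _ (by simp), fun y hy => hfin.mem_toFinset.2 hy⟩

/-- Normalization is `2`-Lipschitz outside the open unit ball. -/
theorem norm_inv_smul_sub_inv_smul_le {E : Type*} [NormedAddCommGroup E] [NormedSpace ℝ E]
    {f g : E} (hf : 1 ≤ ‖f‖) (hg : 1 ≤ ‖g‖) :
    ‖‖f‖⁻¹ • f - ‖g‖⁻¹ • g‖ ≤ 2 * ‖f - g‖ := by
  have hf0 : 0 < ‖f‖ := by linarith
  have hg0 : 0 < ‖g‖ := by linarith
  have hinv : ‖f‖⁻¹ ≤ 1 := inv_le_one_of_one_le₀ hf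
  have e : ‖f‖⁻¹ • f - ‖g‖⁻¹ • g = ‖f‖⁻¹ • ((f - g) + ((‖g‖ - ‖f‖) * ‖g‖⁻¹) • g) := by
    have : ‖g‖⁻¹ = ‖f‖⁻¹ - ‖f‖⁻¹ * ((‖g‖ - ‖f‖) * ‖g‖⁻¹) := by field_simp; ring
    rw [smul_add, smul_smul, smul_sub]
    nth_rewrite 1 [this]
    module
  have h2 : ‖((‖g‖ - ‖f‖) * ‖g‖⁻¹) • g‖ ≤ ‖f - g‖ := by
    rw [norm_smul, norm_mul, norm_inv, norm_norm, mul_assoc, inv_mul_cancel₀ hg0.ne', mul_one,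
      norm_sub_rev f g]
    exact abs_norm_sub_norm_le g f
  rw [e, norm_smul, norm_inv, norm_norm]
  calc ‖f‖⁻¹ * _ ≤ 1 * (‖f - g‖ + ‖f - g‖) := by
        gcongr
        exact (norm_add_le _ _).trans (by gcongr)
    _ = _ := by ring

/-- A uniformly bounded cover with Lebesgue number `2 r` and multiplicity at most `k + 1` yields
uniformly finitely supported unit vectors in `ℓ_p` whose variation is controlled by `k` and `r`. -/
theorem adLE.exists_unit_vectors {X : Type*} [MetricSpace X] {p : ℝ} (hp : 1 < p) {r : ℝ}
    (hr : 0 < r) {k : ℕ} (h : adLE (dist : X → X → ℝ) (2 * r) k) :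
    ∃ a : X → lp (fun _ : X => ℝ) (ENNReal.ofReal p), (∀ z, ‖a z‖ = 1) ∧
      (∀ z y : X, 0 ≤ a z y) ∧ (∃ R : ℝ, ∀ z y : X, a z y ≠ 0 → dist y z ≤ R) ∧
      ∀ z w : X, ∀ c : ℝ, 0 ≤ c → 2 * ((k : ℝ) + 1) * (dist z w / r) ^ p ≤ c ^ p →
        ‖a z - a w‖ ≤ 2 * c := by
  classical
  have hp0 : 0 < p := by linarith
  have : Fact (1 ≤ ENNReal.ofReal p) := ⟨by simpa using hp.le⟩
  have htr : (ENNReal.ofReal p).toReal = p := ENNReal.toReal_ofReal hp0.le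
  have hpne : ENNReal.ofReal p ≠ 0 := by simpa using hp0
  obtain ⟨V, ⟨R, hR⟩, hball, hfin⟩ := h.exists_indexed_cover
  choose S hScard hS using hfin
  let φ : X → X → ℝ := fun z y =>
    (thickenedIndicator hr {x | Metric.closedBall x r ⊆ V y} z : ℝ)
  have hφV : ∀ z y, φ z y ≠ 0 → z ∈ V y := by
    intro z y hne
    by_contra hz
    refine hne ?_
    simp only [φ, NNReal.coe_eq_zero]
    refine thickenedIndicator_zero hr _ fun hmem => hz ?_
    obtain ⟨x, hx, hd⟩ := Metric.mem_thickening_iff.1 hmem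
    exact hx hd.le
  have hφmem : ∀ z, Memℓp (φ z) (ENNReal.ofReal p) := fun z =>
    (memℓp_zero ((S z).finite_toSet.subset fun y hy => hS z y (hφV z y hy))).of_exponent_ge
      zero_le
  let f : X → lp (fun _ : X => ℝ) (ENNReal.ofReal p) := fun z => ⟨φ z, hφmem z⟩
  have hf : ∀ z y, f z y = φ z y := fun _ _ => rfl
  have hone : ∀ z, 1 ≤ ‖f z‖ := by
    intro z
    obtain ⟨y, hy⟩ := hball z hr.le
    have h1 : φ z y = 1 := by
      simp only [φ, NNReal.coe_eq_one]
      exact thickenedIndicator_one hr _ hy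
    have := lp.norm_apply_le_norm hpne (f z) y
    rw [hf, h1, norm_one] at this
    exact this
  have hlip : ∀ z w y, |φ z y - φ w y| ≤ dist z w / r := by
    intro z w y
    have := (lipschitzWith_thickenedIndicator hr {x | Metric.closedBall x r ⊆ V y}).dist_le_mul z w
    rw [NNReal.dist_eq] at this
    refine this.trans (le_of_eq ?_)
    simp [Real.coe_toNNReal _ hr.le]
    ring
  have hsub : ∀ z w c, 0 ≤ c → 2 * ((k : ℝ) + 1) * (dist z w / r) ^ p ≤ c ^ p →
      ‖f z - f w‖ ≤ c := by
    intro z w c hc hle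
    refine lp.norm_le_of_forall_sum_le (by rwa [htr]) hc fun s => ?_
    rw [htr]
    refine le_trans ?_ hle
    have hterm : ∀ y, ‖(f z - f w) y‖ ^ p ≤ (dist z w / r) ^ p := fun y => by
      gcongr
      exact hlip z w y
    have hzero : ∀ y, y ∉ S z ∪ S w → ‖(f z - f w) y‖ ^ p = 0 := by
      intro y hy
      rw [Finset.mem_union, not_or] at hy
      have e1 : φ z y = 0 := by_contra fun hne => hy.1 (hS z y (hφV z y hne))
      have e2 : φ w y = 0 := by_contra fun hne => hy.2 (hS w y (hφV w y hne))
      have : (f z - f w) y = φ z y - φ w y := rfl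
      rw [this, e1, e2, sub_zero, norm_zero, Real.zero_rpow hp0.ne']
    calc ∑ y ∈ s, ‖(f z - f w) y‖ ^ p
        = ∑ y ∈ s with y ∈ S z ∪ S w, ‖(f z - f w) y‖ ^ p :=
          (Finset.sum_filter_of_ne fun y _ hne => by_contra fun hy => hne (hzero y hy)).symm
      _ ≤ ∑ y ∈ S z ∪ S w, ‖(f z - f w) y‖ ^ p :=
          Finset.sum_le_sum_of_subset_of_nonneg (fun y hy => (Finset.mem_filter.1 hy).2)
            fun _ _ _ => by positivity
      _ ≤ (S z ∪ S w).card • (dist z w / r) ^ p := Finset.sum_le_card_nsmul _ _ _ fun y _ => hterm y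
      _ ≤ 2 * ((k : ℝ) + 1) * (dist z w / r) ^ p := by
          rw [nsmul_eq_mul]
          gcongr
          have h1 := Finset.card_union_le (S z) (S w)
          have h2 := hScard z
          have h3 := hScard w
          exact_mod_cast (by omega : (S z ∪ S w).card ≤ 2 * (k + 1))
  have happ : ∀ z y, (‖f z‖⁻¹ • f z) y = ‖f z‖⁻¹ * φ z y := fun _ _ => rfl
  refine ⟨fun z => ‖f z‖⁻¹ • f z, fun z => ?_, fun z y => ?_, ⟨R, fun z y hne => ?_⟩,
    fun z w c hc hle => ?_⟩
  · have : ‖f z‖ ≠ 0 := by linarith [hone z]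
    rw [norm_smul, norm_inv, norm_norm, inv_mul_cancel₀ this]
  · rw [happ]
    exact mul_nonneg (inv_nonneg.2 (norm_nonneg _)) (NNReal.coe_nonneg _)
  · rw [happ] at hne
    exact hR y z (hφV z y (right_ne_zero_of_mul hne))
  · exact (norm_inv_smul_sub_inv_smul_le (hone z) (hone w)).trans (by linarith [hsub z w c hc hle])

/-- If a metric space `(X, dist)` and a real `p > 1` satisfy
`lim_{λ→∞} ad_X(λ)/λ^p = 0` (i.e. `ad_X` is majorized by a function `D` with
`D(λ)/λ^p → 0`), then `X` has property `A_p`. -/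
theorem statement8 (X : Type*) [MetricSpace X] (p : ℝ) (hp : 1 < p)
    (h : ∃ D : ℝ → ℕ,
      (∀ lam : ℝ, 0 < lam → adLE (dist : X → X → ℝ) lam (D lam)) ∧
      Tendsto (fun lam : ℝ => (D lam : ℝ) / lam ^ p) atTop (nhds 0)) :
    HasPropertyA X (ENNReal.ofReal p) := by
  obtain ⟨D, hD, hlim⟩ := h
  have hp0 : 0 < p := by linarith
  have hr : ∀ n : ℕ, (0 : ℝ) < n + 1 := fun n => by positivity
  choose a hnorm hnonneg hsupp hvar using fun n : ℕ =>
    (hD (2 * ((n : ℝ) + 1)) (by positivity)).exists_unit_vectors hp (hr n)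
  choose R hR using hsupp
  refine ⟨a, hnorm, hnonneg, ⟨R, hR⟩, fun K hK ε hε => ?_⟩
  have hlam : Tendsto (fun n : ℕ => 2 * ((n : ℝ) + 1)) atTop atTop :=
    (tendsto_natCast_atTop_atTop.atTop_add tendsto_const_nhds).const_mul_atTop two_pos
  have hlim' : Tendsto (fun lam : ℝ => 2 * (2 * K) ^ p * ((D lam : ℝ) / lam ^ p + (lam ^ p)⁻¹))
      atTop (nhds 0) := by
    simpa using (hlim.add (tendsto_rpow_atTop hp0).inv_tendsto_atTop).const_mul (2 * (2 * K) ^ p)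
  have hev := (hlim'.comp hlam).eventually_le_const
    (by positivity : 0 < (ε / 2) ^ p)
  obtain ⟨N, hN⟩ := eventually_atTop.1 hev
  refine ⟨N, fun n hn z w hzw => ?_⟩
  refine (hvar n z w (ε / 2) (by positivity) (le_trans ?_ (hN n hn))).trans (by linarith)
  have hpow : (dist z w / ((n : ℝ) + 1)) ^ p ≤ (2 * K) ^ p / (2 * ((n : ℝ) + 1)) ^ p := by
    rw [← Real.div_rpow (by positivity) (by positivity), mul_div_mul_left _ _ two_ne_zero]
    gcongr
  calc _ ≤ 2 * ((D (2 * ((n : ℝ) + 1)) : ℝ) + 1) *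
        ((2 * K) ^ p / (2 * ((n : ℝ) + 1)) ^ p) := by gcongr
    _ = _ := by
        simp only [Function.comp_apply]
        ring
end

section
/- Suppose a discrete metric space (X, ρ) has polynomial dimension growth, i.e., there exist C > 0 and k ∈ ℕ such that ad_X(λ) ≤ C(1 + λ)^k for all λ > 0. Then X has property A_1. -/
open scoped ENNReal

open Classical in
/-- The uniform probability vector on a finite set `S`, pushed forward along `p`. -/
noncomputable def uniformVec {ι X : Type*} (p : ι → X) (S : Finset ι) :
    lp (fun _ : X => ℝ) 1 :=
  (S.card : ℝ)⁻¹ • ∑ i ∈ S, lp.single 1 (p i) (1 : ℝ)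

theorem lp_one_norm_eq_one_of_hasSum {X : Type*} {f : lp (fun _ : X => ℝ) 1}
    (h0 : ∀ y, 0 ≤ f y) (h : HasSum (fun y => f y) 1) : ‖f‖ = 1 := by
  rw [lp.norm_eq_tsum_rpow (by simp) f]
  simp [Real.norm_eq_abs, abs_of_nonneg (h0 _), h.tsum_eq]

section UniformVec

variable {ι X : Type*} (p : ι → X)

theorem uniformVec_apply [DecidableEq X] (S : Finset ι) (y : X) :
    uniformVec p S y = (S.card : ℝ)⁻¹ * ∑ i ∈ S, if y = p i then (1 : ℝ) else 0 := by
  simp only [uniformVec, lp.coeFn_smul, Pi.smul_apply, lp.coeFn_sum, Finset.sum_apply,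
    smul_eq_mul, lp.coeFn_single, Pi.single_apply]
  congr! 3

theorem uniformVec_nonneg (S : Finset ι) (y : X) : 0 ≤ uniformVec p S y := by
  classical
  rw [uniformVec_apply]
  exact mul_nonneg (by positivity) (Finset.sum_nonneg fun i _ => by split_ifs <;> norm_num)

theorem exists_mem_of_uniformVec_ne_zero {S : Finset ι} {y : X} (h : uniformVec p S y ≠ 0) :
    ∃ i ∈ S, y = p i := by
  classical
  by_contra! hS
  refine h ?_
  rw [uniformVec_apply, Finset.sum_eq_zero fun i hi => if_neg (hS i hi), mul_zero]

theorem hasSum_uniformVec {S : Finset ι} (hS : S.Nonempty) :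
    HasSum (fun y => uniformVec p S y) 1 := by
  classical
  have hc : (S.card : ℝ) ≠ 0 := by exact_mod_cast hS.card_ne_zero
  have h := (hasSum_sum (s := S) fun i _ =>
    hasSum_ite_eq (p i) (1 : ℝ)).mul_left (S.card : ℝ)⁻¹
  simp only [uniformVec_apply]
  simpa [hc] using h

theorem norm_uniformVec_sub_le {S T : Finset ι} (hS : S.Nonempty) (hST : S ⊆ T) :
    ‖uniformVec p T - uniformVec p S‖ ≤ 2 * (Real.log T.card - Real.log S.card) := by
  classical
  have hs : (0 : ℝ) < S.card := by exact_mod_cast hS.card_pos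
  have ht : (0 : ℝ) < T.card := by exact_mod_cast (hS.mono hST).card_pos
  have hst : (S.card : ℝ) ≤ T.card := by exact_mod_cast Finset.card_le_card hST
  have hsum : ∀ R : Finset ι,
      ‖∑ i ∈ R, (lp.single 1 (p i) (1 : ℝ) : lp (fun _ : X => ℝ) 1)‖ ≤ R.card := fun R => by
    refine (norm_sum_le _ _).trans ?_
    simp [lp.norm_single]
  have hdecomp : uniformVec p T - uniformVec p S =
      (T.card : ℝ)⁻¹ • ∑ i ∈ T \ S, (lp.single 1 (p i) (1 : ℝ) : lp (fun _ : X => ℝ) 1) -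
      ((S.card : ℝ)⁻¹ - (T.card : ℝ)⁻¹) •
        ∑ i ∈ S, (lp.single 1 (p i) (1 : ℝ) : lp (fun _ : X => ℝ) 1) := by
    have hT : uniformVec p T = (T.card : ℝ)⁻¹ •
        ∑ i ∈ T, (lp.single 1 (p i) (1 : ℝ) : lp (fun _ : X => ℝ) 1) := by
      unfold uniformVec; congr!
    have hS' : uniformVec p S = (S.card : ℝ)⁻¹ •
        ∑ i ∈ S, (lp.single 1 (p i) (1 : ℝ) : lp (fun _ : X => ℝ) 1) := by
      unfold uniformVec; congr!
    rw [hT, hS', ← Finset.sum_sdiff hST]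
    module
  have hinv : (0 : ℝ) ≤ (S.card : ℝ)⁻¹ - (T.card : ℝ)⁻¹ :=
    sub_nonneg.2 (inv_anti₀ hs hst)
  have hdiff : ((T \ S).card : ℝ) = T.card - S.card := by
    rw [Finset.cast_card_sdiff hST]
  have hlog : 1 - (S.card : ℝ) / T.card ≤ Real.log T.card - Real.log S.card := by
    have := Real.one_sub_inv_le_log_of_pos (div_pos ht hs)
    rwa [inv_div, Real.log_div ht.ne' hs.ne'] at this
  calc ‖uniformVec p T - uniformVec p S‖
      ≤ (T.card : ℝ)⁻¹ * (T.card - S.card) +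
          ((S.card : ℝ)⁻¹ - (T.card : ℝ)⁻¹) * S.card := by
        rw [hdecomp]
        refine (norm_sub_le _ _).trans (add_le_add ?_ ?_)
        · rw [norm_smul, Real.norm_of_nonneg (by positivity), ← hdiff]
          exact mul_le_mul_of_nonneg_left (hsum _) (by positivity)
        · rw [norm_smul, Real.norm_of_nonneg hinv]
          exact mul_le_mul_of_nonneg_left (hsum _) hinv
    _ = 2 * (1 - (S.card : ℝ) / T.card) := by field_simp; ring
    _ ≤ _ := by linarith

end UniformVec

theorem sum_range_sub_shift_le {f : ℕ → ℝ} {M : ℝ} (n q : ℕ) (h0 : ∀ j < n + q, 0 ≤ f j)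
    (hM : ∀ j < n + q, f j ≤ M) : ∑ j ∈ Finset.range n, (f j - f (q + j)) ≤ q * M := by
  have h1 := Finset.sum_range_add f n q
  have h2 := Finset.sum_range_add f q n
  have h3 : 0 ≤ ∑ j ∈ Finset.range q, f (n + j) :=
    Finset.sum_nonneg fun j hj => h0 _ (by have := Finset.mem_range.1 hj; omega)
  have h4 : ∑ j ∈ Finset.range q, f j ≤ q * M := by
    simpa using Finset.sum_le_card_nsmul (Finset.range q) f M
      fun j hj => hM _ (by have := Finset.mem_range.1 hj; omega)
  rw [Nat.add_comm q n] at h2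
  rw [Finset.sum_sub_distrib]
  linarith

/-- A uniformly bounded cover with Lebesgue number `6 N` and multiplicity at most `B` yields
almost invariant unit vectors in `ℓ¹`. -/
theorem exists_almost_invariant_of_cover {X : Type*} [MetricSpace X] {𝒰 : Set (Set X)}
    (hbdd : UniformlyBounded (dist : X → X → ℝ) 𝒰) {N : ℕ} (hN : 0 < N)
    (hleb : IsLebesgueNumber (dist : X → X → ℝ) 𝒰 (6 * N)) {B : ℝ}
    (hmult : ∀ F : Finset (Set X), ↑F ⊆ 𝒰 → (⋂₀ (F : Set (Set X))).Nonempty →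
      (F.card : ℝ) ≤ B) :
    ∃ a : X → lp (fun _ : X => ℝ) 1, (∀ z, ‖a z‖ = 1) ∧ (∀ z y, 0 ≤ a z y) ∧
      (∃ R : ℝ, ∀ z y, a z y ≠ 0 → dist y z ≤ R) ∧
      ∀ m : ℕ, m ≤ N → ∀ z w, dist z w ≤ m → ‖a z - a w‖ ≤ 8 * m * Real.log B / N := by
  rcases isEmpty_or_nonempty X with hX | hX
  · exact ⟨isEmptyElim, isEmptyElim, isEmptyElim, ⟨0, isEmptyElim⟩, fun _ _ => isEmptyElim⟩
  obtain ⟨p, hp⟩ : ∃ p : Set X → X, ∀ U : Set X, U.Nonempty → p U ∈ U :=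
    ⟨fun U => Classical.epsilon (· ∈ U), fun _ hU => Classical.epsilon_spec hU⟩
  obtain ⟨D, hD⟩ := hbdd
  have hfin : ∀ (x : X) (j : ℕ), {U ∈ 𝒰 | Metric.closedBall x j ⊆ U}.Finite := by
    intro x j
    by_contra hinf
    obtain ⟨F, hF, hcard⟩ := Set.Infinite.exists_subset_card_eq hinf (⌊B⌋₊ + 1)
    have := hmult F (fun U hU => (hF hU).1)
      ⟨x, fun U hU => (hF hU).2 (Metric.mem_closedBall_self (by positivity))⟩
    rw [hcard] at this
    push_cast at this
    linarith [Nat.lt_floor_add_one B]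
  set S : X → ℕ → Finset (Set X) := fun x j => (hfin x j).toFinset with hSdef
  have hS : ∀ {x j U}, U ∈ S x j ↔ U ∈ 𝒰 ∧ Metric.closedBall x j ⊆ U := by
    intro x j U
    simp [hSdef]
  have hself : ∀ {x j U}, U ∈ S x j → x ∈ U := fun hU =>
    (hS.1 hU).2 (Metric.mem_closedBall_self (by positivity))
  have hne : ∀ x j, j ≤ 3 * N → (S x j).Nonempty := by
    intro x j hj
    obtain ⟨U, hU, hsub⟩ := hleb (Metric.closedBall x j) fun y hy z hz => by
      have h1 := dist_triangle_right y z x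
      rw [Metric.mem_closedBall] at hy hz
      have h2 : (j : ℝ) ≤ 3 * N := by exact_mod_cast hj
      linarith
    exact ⟨U, hS.2 ⟨hU, hsub⟩⟩
  have hcard : ∀ x j, ((S x j).card : ℝ) ≤ B := fun x j =>
    hmult _ (fun U hU => (hS.1 hU).1) ⟨x, fun U hU => hself hU⟩
  have hmono : ∀ {x y i j} {m : ℕ}, dist x y ≤ m → i + m ≤ j → S x j ⊆ S y i := by
    intro x y i j m hxy hij U hU
    obtain ⟨hU, hsub⟩ := hS.1 hU
    refine hS.2 ⟨hU, (Metric.closedBall_subset_closedBall' ?_).trans hsub⟩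
    have : (i : ℝ) + m ≤ j := by exact_mod_cast hij
    rw [dist_comm]
    linarith
  have hNpos : (0 : ℝ) < N := by exact_mod_cast hN
  set a : X → lp (fun _ : X => ℝ) 1 := fun z =>
    (N : ℝ)⁻¹ • ∑ j ∈ Finset.range N, uniformVec p (S z (N + j)) with hadef
  have ha : ∀ z y, a z y = (N : ℝ)⁻¹ * ∑ j ∈ Finset.range N, uniformVec p (S z (N + j)) y := by
    intro z y
    simp only [hadef, lp.coeFn_smul, Pi.smul_apply, lp.coeFn_sum, Finset.sum_apply, smul_eq_mul]
  have ha0 : ∀ z y, 0 ≤ a z y := fun z y => by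
    rw [ha]
    exact mul_nonneg (by positivity) (Finset.sum_nonneg fun j _ => uniformVec_nonneg _ _ _)
  refine ⟨a, fun z => lp_one_norm_eq_one_of_hasSum (ha0 z) ?_, ha0, ⟨D, ?_⟩, ?_⟩
  · have h := (hasSum_sum (s := Finset.range N) fun j hj =>
      hasSum_uniformVec p (hne z (N + j) (by have := Finset.mem_range.1 hj; omega))).mul_left
        (N : ℝ)⁻¹
    simp only [ha]
    simpa [hNpos.ne'] using h
  · intro z y hzy
    rw [ha] at hzy
    obtain ⟨j, -, hj⟩ := Finset.exists_ne_zero_of_sum_ne_zero (right_ne_zero_of_mul hzy)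
    obtain ⟨U, hU, rfl⟩ := exists_mem_of_uniformVec_ne_zero p hj
    exact hD U (hS.1 hU).1 _ (hp U ⟨z, hself hU⟩) _ (hself hU)
  · intro m hm z w hzw
    set f : ℕ → ℝ := fun j => Real.log (S z (N - m + j)).card with hf
    have hterm : ∀ j ∈ Finset.range N,
        ‖uniformVec p (S z (N + j)) - uniformVec p (S w (N + j))‖ ≤
          4 * (f j - f (2 * m + j)) := by
      intro j hj
      have hjN := Finset.mem_range.1 hj
      have hz := norm_uniformVec_sub_le p (hne z (N + j) (by omega))
        (hmono (x := z) (y := z) (i := N - m + j) (m := m) (by simp) (by omega))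
      have hw := norm_uniformVec_sub_le p (hne w (N + j) (by omega))
        (hmono (x := w) (y := z) (i := N - m + j) (m := m) (by rwa [dist_comm]) (by omega))
      have hlog : ∀ v, dist z v ≤ m →
          f (2 * m + j) ≤ Real.log (S v (N + j)).card := fun v hv => by
        refine Real.log_le_log (by exact_mod_cast (hne z _ (by omega)).card_pos) ?_
        exact_mod_cast Finset.card_le_card (hmono hv (by omega))
      have h1 := hlog z (by simp)
      have h2 := hlog w hzw
      have h3 := norm_sub_le_norm_sub_add_norm_sub (uniformVec p (S z (N + j)))
        (uniformVec p (S z (N - m + j))) (uniformVec p (S w (N + j)))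
      rw [norm_sub_rev _ (uniformVec p (S z (N - m + j)))] at h3
      simp only [hf] at h1 h2 ⊢
      linarith
    have hshift := sum_range_sub_shift_le (f := f) (M := Real.log B) N (2 * m)
      (fun j _ => Real.log_natCast_nonneg _) fun j hj =>
        Real.log_le_log (by exact_mod_cast (hne z _ (by omega)).card_pos) (hcard _ _)
    calc ‖a z - a w‖
        = (N : ℝ)⁻¹ * ‖∑ j ∈ Finset.range N,
            (uniformVec p (S z (N + j)) - uniformVec p (S w (N + j)))‖ := by
          rw [hadef, ← smul_sub, ← Finset.sum_sub_distrib, norm_smul,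
            Real.norm_of_nonneg (by positivity)]
      _ ≤ (N : ℝ)⁻¹ * (4 * ((2 * m : ℕ) * Real.log B)) := by
          refine mul_le_mul_of_nonneg_left ((norm_sum_le_of_le _ hterm).trans ?_) (by positivity)
          rw [← Finset.mul_sum]
          linarith
      _ = 8 * m * Real.log B / N := by push_cast; ring

theorem tendsto_log_polynomial_div_atTop {C : ℝ} (hC : 0 < C) (k : ℕ) :
    Filter.Tendsto (fun n : ℕ => Real.log (C * (1 + 6 * ((n + 1 : ℕ) : ℝ)) ^ k + 1) /
      ((n + 1 : ℕ) : ℝ)) Filter.atTop (nhds 0) := by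
  have hN : Filter.Tendsto (fun n : ℕ => ((n + 1 : ℕ) : ℝ)) Filter.atTop Filter.atTop :=
    tendsto_natCast_atTop_atTop.comp (Filter.tendsto_add_atTop_nat 1)
  have hlog := (Real.isLittleO_log_id_atTop.tendsto_div_nhds_zero.comp hN).const_mul (k : ℝ)
  have hconst := hN.const_div_atTop (Real.log (C + 1) + k * Real.log 7)
  have hsum := hconst.add hlog
  rw [mul_zero, add_zero] at hsum
  refine squeeze_zero (fun n => ?_) (fun n => ?_) hsum
  · exact div_nonneg (Real.log_nonneg (le_add_of_nonneg_left (by positivity))) (by positivity)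
  · have hx : (1 : ℝ) ≤ ((n + 1 : ℕ) : ℝ) := by exact_mod_cast Nat.succ_pos n
    simp only [Function.comp_apply, id]
    generalize ((n + 1 : ℕ) : ℝ) = x at hx ⊢
    have hx0 : 0 < x := by linarith
    have hle : C * (1 + 6 * x) ^ k + 1 ≤ (C + 1) * (7 * x) ^ k := by
      have h1 : (1 + 6 * x) ^ k ≤ (7 * x) ^ k := by gcongr; linarith
      have h2 : 1 ≤ (7 * x) ^ k := one_le_pow₀ (by linarith)
      nlinarith
    have h := Real.log_le_log (by positivity) hle
    rw [Real.log_mul (by positivity) (by positivity), Real.log_pow,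
      Real.log_mul (by norm_num) hx0.ne'] at h
    rw [← mul_div_assoc, ← add_div]
    gcongr
    linarith

/-- If a metric space `(X, dist)` has polynomial dimension growth, i.e.
there are `C > 0` and `k ∈ ℕ` with `ad_X(λ) ≤ C(1+λ)^k` for all `λ > 0`, then `X` has
property `A_1`. -/
theorem statement9 (X : Type*) [MetricSpace X]
    (h : ∃ C : ℝ, 0 < C ∧ ∃ k : ℕ, ∀ lam : ℝ, 0 < lam →
      adLE (dist : X → X → ℝ) lam (C * (1 + lam) ^ k)) :
    HasPropertyA X 1 := by
  obtain ⟨C, hC, k, h⟩ := h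
  have key : ∀ n : ℕ, ∃ a : X → lp (fun _ : X => ℝ) 1,
      (∀ z, ‖a z‖ = 1) ∧ (∀ z y, 0 ≤ a z y) ∧ (∃ R : ℝ, ∀ z y, a z y ≠ 0 → dist y z ≤ R) ∧
      ∀ m : ℕ, m ≤ n + 1 → ∀ z w, dist z w ≤ m → ‖a z - a w‖ ≤
        8 * m * Real.log (C * (1 + 6 * ((n + 1 : ℕ) : ℝ)) ^ k + 1) / ((n + 1 : ℕ) : ℝ) := by
    intro n
    obtain ⟨𝒰, -, hbdd, hleb, hmult⟩ := h (6 * ((n + 1 : ℕ) : ℝ)) (by positivity)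
    exact exists_almost_invariant_of_cover hbdd n.succ_pos hleb hmult
  choose a hnorm hnonneg hsupp hinv using key
  choose R hR using hsupp
  refine ⟨a, hnorm, hnonneg, ⟨R, hR⟩, fun K _ ε hε => ?_⟩
  obtain ⟨m, hm⟩ := exists_nat_ge K
  have hlim := (tendsto_log_polynomial_div_atTop hC k).const_mul (8 * (m : ℝ))
  rw [mul_zero] at hlim
  obtain ⟨N, hN⟩ := Filter.eventually_atTop.1 (hlim.eventually_le_const hε)
  refine ⟨max N m, fun n hn z w hzw => ?_⟩
  refine (hinv n m (by omega) z w (hzw.trans hm)).trans ?_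
  rw [mul_div_assoc]
  exact hN n (le_trans (le_max_left _ _) hn)
end

section
/- Let π : G → H be a surjective homomorphism of finitely generated groups; give G the word metric of a finite symmetric generating set S, give H the word metric of π(S), and let K = ker π carry the metric restricted from G. Let λ > 0 and R ≥ λ. Suppose 𝒰 is a cover of H with L(𝒰) ≥ λ and diam(𝒰) ≤ R, and 𝒱 is a cover of K with L(𝒱) ≥ 6R and diam(𝒱) ≤ D. Then there is a cover 𝒲 of G with L(𝒲) ≥ λ, diam(𝒲) ≤ D + 2R, and m(𝒲) ≤ m(𝒰)·m(𝒱). -/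
section WordNorm

variable {G H : Type*} [Group G] [Group H] {S : Set G}

theorem wordNorm_prod_le {l : List G} (hl : ∀ s ∈ l, s ∈ S) : wordNorm S l.prod ≤ l.length :=
  Nat.sInf_le ⟨l, hl, rfl, rfl⟩

theorem exists_list_of_closure_eq_top (hsymm : ∀ s ∈ S, s⁻¹ ∈ S)
    (hgen : Subgroup.closure S = ⊤) (g : G) :
    ∃ l : List G, (∀ s ∈ l, s ∈ S) ∧ l.prod = g ∧ l.length = wordNorm S g := by
  have hg : g ∈ Submonoid.closure (S ∪ S⁻¹) := by
    rw [← Subgroup.closure_toSubmonoid, hgen]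
    exact Subgroup.mem_top g
  obtain ⟨l, hl, hg⟩ := Submonoid.exists_list_of_mem_closure hg
  have hl' : ∀ s ∈ l, s ∈ S := fun s hs =>
    (hl s hs).elim id fun h => inv_inv s ▸ hsymm _ h
  exact Nat.sInf_mem
    (s := {n : ℕ | ∃ l : List G, (∀ s ∈ l, s ∈ S) ∧ l.prod = g ∧ l.length = n})
    ⟨_, l, hl', hg, rfl⟩

theorem wordNorm_one : wordNorm S 1 = 0 :=
  Nat.le_zero.mp (wordNorm_prod_le (l := []) (by simp))

theorem wordNorm_mul_le (hsymm : ∀ s ∈ S, s⁻¹ ∈ S) (hgen : Subgroup.closure S = ⊤) (g h : G) :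
    wordNorm S (g * h) ≤ wordNorm S g + wordNorm S h := by
  obtain ⟨l, hl, rfl, hn⟩ := exists_list_of_closure_eq_top hsymm hgen g
  obtain ⟨m, hm, rfl, hk⟩ := exists_list_of_closure_eq_top hsymm hgen h
  rw [← hn, ← hk, ← List.prod_append, ← List.length_append]
  refine wordNorm_prod_le fun s hs => ?_
  exact (List.mem_append.mp hs).elim (hl s) (hm s)

theorem wordNorm_inv_le (hsymm : ∀ s ∈ S, s⁻¹ ∈ S) (hgen : Subgroup.closure S = ⊤) (g : G) :
    wordNorm S g⁻¹ ≤ wordNorm S g := by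
  obtain ⟨l, hl, rfl, hn⟩ := exists_list_of_closure_eq_top hsymm hgen g
  rw [← hn, List.prod_inv_reverse]
  refine (wordNorm_prod_le fun s hs => ?_).trans (by simp)
  obtain ⟨t, ht, rfl⟩ := List.mem_map.mp (List.mem_reverse.mp hs)
  exact hsymm t (hl t ht)

theorem wordNorm_map_le (hsymm : ∀ s ∈ S, s⁻¹ ∈ S) (hgen : Subgroup.closure S = ⊤)
    (π : G →* H) (g : G) : wordNorm (π '' S) (π g) ≤ wordNorm S g := by
  obtain ⟨l, hl, rfl, hn⟩ := exists_list_of_closure_eq_top hsymm hgen g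
  rw [← hn, map_list_prod]
  refine (wordNorm_prod_le fun s hs => ?_).trans (by simp)
  obtain ⟨t, ht, rfl⟩ := List.mem_map.mp hs
  exact ⟨t, hl t ht, rfl⟩

theorem exists_map_eq_wordNorm_le (hsymm : ∀ s ∈ S, s⁻¹ ∈ S) (hgen : Subgroup.closure S = ⊤)
    {π : G →* H} (hsurj : Function.Surjective π) (h : H) :
    ∃ g : G, π g = h ∧ wordNorm S g ≤ wordNorm (π '' S) h := by
  have hsymm' : ∀ t ∈ π '' S, t⁻¹ ∈ π '' S := by
    rintro _ ⟨s, hs, rfl⟩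
    exact ⟨s⁻¹, hsymm s hs, map_inv π s⟩
  have hgen' : Subgroup.closure (π '' S) = ⊤ := by
    rw [← MonoidHom.map_closure, hgen, Subgroup.map_top_of_surjective π hsurj]
  obtain ⟨l, hl, rfl, hn⟩ := exists_list_of_closure_eq_top hsymm' hgen' h
  obtain ⟨m, hm, rfl⟩ : ∃ m : List G, (∀ s ∈ m, s ∈ S) ∧ m.map π = l := by
    clear hn
    induction l with
    | nil => exact ⟨[], by simp, rfl⟩
    | cons a l ih =>
      obtain ⟨m, hm, rfl⟩ := ih fun s hs => hl s (List.mem_cons_of_mem a hs)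
      obtain ⟨s, hs, rfl⟩ := hl a List.mem_cons_self
      exact ⟨s :: m, by simpa [hs] using hm, rfl⟩
  exact ⟨m.prod, map_list_prod π m, by simpa [← hn] using wordNorm_prod_le hm⟩

theorem wordDist_self (g : G) : wordDist S g g = 0 := by
  simp [wordDist, wordNorm_one]

theorem wordDist_mul_left (k g h : G) : wordDist S (k * g) (k * h) = wordDist S g h := by
  simp [wordDist, mul_assoc]

theorem wordDist_triangle (hsymm : ∀ s ∈ S, s⁻¹ ∈ S) (hgen : Subgroup.closure S = ⊤)
    (g h k : G) : wordDist S g k ≤ wordDist S g h + wordDist S h k := by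
  unfold wordDist
  have := wordNorm_mul_le hsymm hgen (g⁻¹ * h) (h⁻¹ * k)
  rw [show g⁻¹ * h * (h⁻¹ * k) = g⁻¹ * k by group] at this
  exact_mod_cast this

theorem wordDist_comm (hsymm : ∀ s ∈ S, s⁻¹ ∈ S) (hgen : Subgroup.closure S = ⊤) (g h : G) :
    wordDist S g h = wordDist S h g := by
  have key : ∀ a b : G, wordNorm S (a⁻¹ * b) ≤ wordNorm S (b⁻¹ * a) := fun a b => by
    simpa using wordNorm_inv_le hsymm hgen (b⁻¹ * a)
  exact congrArg Nat.cast (le_antisymm (key g h) (key h g))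

theorem wordDist_map_le (hsymm : ∀ s ∈ S, s⁻¹ ∈ S) (hgen : Subgroup.closure S = ⊤)
    (π : G →* H) (g h : G) : wordDist (π '' S) (π g) (π h) ≤ wordDist S g h := by
  unfold wordDist
  have := wordNorm_map_le hsymm hgen π (g⁻¹ * h)
  rw [map_mul, map_inv] at this
  exact_mod_cast this

theorem exists_ker_wordDist_le (hsymm : ∀ s ∈ S, s⁻¹ ∈ S) (hgen : Subgroup.closure S = ⊤)
    {π : G →* H} (hsurj : Function.Surjective π) (x g : G) :
    ∃ k : π.ker, wordDist S x (g * k) ≤ wordDist (π '' S) (π x) (π g) := by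
  obtain ⟨y, hy, hle⟩ := exists_map_eq_wordNorm_le hsymm hgen hsurj ((π x)⁻¹ * π g)
  refine ⟨⟨g⁻¹ * (x * y), by simp [MonoidHom.mem_ker, hy]⟩, ?_⟩
  simpa [wordDist] using hle

end WordNorm

/-- Intersecting the preimage under `p` of each `U` in `𝒰` with the preimages under `r U` of
the members of `𝒱` gives a family whose multiplicity is at most the product of the two. -/
theorem MultiplicityLE.image2_preimage_inter {X Y Z : Type*} {𝒰 : Set (Set Y)} {𝒱 : Set (Set Z)}
    {m n : ℕ} (hm : MultiplicityLE 𝒰 m) (hn : MultiplicityLE 𝒱 n) (p : X → Y)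
    (r : Set Y → X → Z) :
    MultiplicityLE (Set.image2 (fun U V => p ⁻¹' U ∩ r U ⁻¹' V) 𝒰 𝒱) (m * n) := by
  classical
  rintro F hF ⟨x, hx⟩
  choose! u hu v hv huv using fun W (hW : W ∈ F) => hF hW
  have hmem : ∀ W ∈ F, p x ∈ u W ∧ r (u W) x ∈ v W := fun W hW => by
    have hxW : x ∈ W := hx W hW
    rwa [← huv W hW] at hxW
  have hbase : (F.image u).card ≤ m := by
    refine hm _ ?_ ⟨p x, ?_⟩
    · simpa [Set.subset_def] using hu
    · simpa using fun W hW => (hmem W hW).1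
  have hfiber : ∀ U ∈ F.image u, {W ∈ F | u W = U}.card ≤ n := by
    intro U _
    rw [← Finset.card_image_of_injOn (f := v)]
    · refine hn _ ?_ ⟨r U x, ?_⟩
      · rintro _ hV
        obtain ⟨W, hW, rfl⟩ := Finset.mem_image.mp hV
        exact hv W (Finset.mem_filter.mp hW).1
      · rintro _ hV
        obtain ⟨W, hW, rfl⟩ := Finset.mem_image.mp hV
        obtain ⟨hWF, rfl⟩ := Finset.mem_filter.mp hW
        exact (hmem W hWF).2
    · intro W hW W' hW' h
      obtain ⟨hWF, hWU⟩ := Finset.mem_filter.mp hW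
      obtain ⟨hWF', hWU'⟩ := Finset.mem_filter.mp hW'
      rw [← huv W hWF, ← huv W' hWF', hWU, hWU', h]
  calc F.card ≤ n * (F.image u).card := Finset.card_le_mul_card_image F n hfiber
    _ ≤ n * m := Nat.mul_le_mul_left n hbase
    _ = m * n := mul_comm n m

/-- Let `π : G → H` be a surjective homomorphism of finitely generated
groups; `G` carries the word metric of a finite symmetric generating set `S`, `H` the
word metric of `π(S)`, and `K = ker π` the metric restricted from `G`. If `λ > 0`,
`R ≥ λ`, `𝒰` is a cover of `H` with `L(𝒰) ≥ λ` and `diam(𝒰) ≤ R`, and `𝒱` is a cover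
of `K` with `L(𝒱) ≥ 6R` and `diam(𝒱) ≤ D`, then there is a cover `𝒲` of `G` with
`L(𝒲) ≥ λ`, `diam(𝒲) ≤ D + 2R` and `m(𝒲) ≤ m(𝒰)·m(𝒱)`. -/
theorem statement14 (G H : Type*) [Group G] [Group H] (π : G →* H)
    (hsurj : Function.Surjective π) (S : Set G) (hfin : S.Finite)
    (hsymm : ∀ s ∈ S, s⁻¹ ∈ S) (hgen : Subgroup.closure S = ⊤)
    (lam R D : ℝ) (hlam : 0 < lam) (hlamR : lam ≤ R)
    (𝒰 : Set (Set H)) (hUcov : IsCover 𝒰)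
    (hUleb : IsLebesgueNumber (wordDist (π '' S)) 𝒰 lam)
    (hUdiam : FamilyDiamLE (wordDist (π '' S)) 𝒰 R)
    (𝒱 : Set (Set ↥π.ker)) (hVcov : IsCover 𝒱)
    (hVleb : IsLebesgueNumber (fun x y : ↥π.ker => wordDist S (x : G) (y : G)) 𝒱 (6 * R))
    (hVdiam : FamilyDiamLE (fun x y : ↥π.ker => wordDist S (x : G) (y : G)) 𝒱 D)
    (mU mV : ℕ) (hmU : MultiplicityLE 𝒰 mU) (hmV : MultiplicityLE 𝒱 mV) :
    ∃ 𝒲 : Set (Set G), IsCover 𝒲 ∧ IsLebesgueNumber (wordDist S) 𝒲 lam ∧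
      FamilyDiamLE (wordDist S) 𝒲 (D + 2 * R) ∧ MultiplicityLE 𝒲 (mU * mV) := by
  have hretract : ∀ U ∈ 𝒰, ∃ g : G, ∃ r : G → π.ker, ∀ x, π x ∈ U →
      wordDist S x (g * r x) ≤ R := by
    intro U hU
    rcases U.eq_empty_or_nonempty with rfl | ⟨h, hh⟩
    · exact ⟨1, fun _ => 1, fun x hx => hx.elim⟩
    · obtain ⟨g, rfl⟩ := hsurj h
      choose r hr using fun x => exists_ker_wordDist_le hsymm hgen hsurj x g
      exact ⟨g, r, fun x hx => (hr x).trans (hUdiam U hU _ hx _ hh)⟩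
  choose! g r hr using hretract
  have hleb : IsLebesgueNumber (wordDist S)
      (Set.image2 (fun U V => π ⁻¹' U ∩ r U ⁻¹' V) 𝒰 𝒱) lam := by
    intro A hA
    obtain ⟨U, hU, hAU⟩ := hUleb (π '' A) (by
      rintro _ ⟨x, hx, rfl⟩ _ ⟨y, hy, rfl⟩
      exact (wordDist_map_le hsymm hgen π x y).trans (hA x hx y hy))
    obtain ⟨V, hV, hAV⟩ := hVleb (r U '' A) (by
      rintro _ ⟨x, hx, rfl⟩ _ ⟨y, hy, rfl⟩
      have hx' := hr U hU x (hAU ⟨x, hx, rfl⟩)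
      have hy' := hr U hU y (hAU ⟨y, hy, rfl⟩)
      rw [wordDist_comm hsymm hgen] at hx'
      beta_reduce
      rw [← wordDist_mul_left (g U)]
      linarith [hA x hx y hy, wordDist_triangle hsymm hgen (g U * r U x) x (g U * r U y),
        wordDist_triangle hsymm hgen x y (g U * r U y)])
    exact ⟨_, Set.mem_image2_of_mem hU hV, fun x hx => ⟨hAU ⟨x, hx, rfl⟩, hAV ⟨x, hx, rfl⟩⟩⟩
  refine ⟨_, fun x => ?_, hleb, ?_, hmU.image2_preimage_inter hmV π r⟩
  · obtain ⟨W, hW, hxW⟩ := hleb {x} (by simpa [wordDist_self] using hlam.le)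
    exact ⟨W, hW, hxW rfl⟩
  · rintro _ ⟨U, hU, V, hV, rfl⟩ x ⟨hxU, hxV⟩ y ⟨hyU, hyV⟩
    have hx := hr U hU x hxU
    have hy := hr U hU y hyU
    have hxy : wordDist S (r U x : G) (r U y) ≤ D := hVdiam V hV _ hxV _ hyV
    rw [wordDist_comm hsymm hgen] at hy
    rw [← wordDist_mul_left (g U)] at hxy
    linarith [wordDist_triangle hsymm hgen x (g U * r U x) y,
      wordDist_triangle hsymm hgen (g U * r U x) (g U * r U y) y]
end

section
/- For every finitely generated nilpotent group N there is k ∈ ℕ such that asdim N ≤ k and Gromov's function γ_N for the inequality asdim N ≤ k, taken with respect to a word metric on N, is bounded above by a polynomial. -/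
/-- Gromov's function `γ_X` for the inequality `asdim X ≤ m` is bounded by `p`:
for every `λ > 0` there is a cover `𝒰` of `X` with Lebesgue number at least `λ`,
multiplicity at most `m + 1`, and diameter at most `p(λ)`. -/
def GromovLE {X : Type*} (d : X → X → ℝ) (m : ℕ) (p : ℝ → ℝ) : Prop :=
  ∀ lam : ℝ, 0 < lam → ∃ 𝒰 : Set (Set X), IsCover 𝒰 ∧ IsLebesgueNumber d 𝒰 lam ∧
    MultiplicityLE 𝒰 (m + 1) ∧ FamilyDiamLE d 𝒰 (p lam)

section Growth

open scoped Pointwise commutatorElement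

variable {G : Type*} [Group G]

theorem iterate_commutator_mem_lowerCentralSeries (s : G) {j : ℕ} {x : G}
    (hx : x ∈ (⊤ : Subgroup G).lowerCentralSeries j) (i : ℕ) :
    (fun y => ⁅s, y⁆)^[i] x ∈ (⊤ : Subgroup G).lowerCentralSeries (j + i) := by
  induction i with
  | zero => exact hx
  | succ i ih =>
    rw [Function.iterate_succ_apply', ← add_assoc, Subgroup.lowerCentralSeries_succ,
      Subgroup.commutator_comm]
    exact Subgroup.commutator_mem_commutator (Subgroup.mem_top s) ih

variable [DecidableEq G]

/-- The number of products of `n` elements of `S` is bounded by a polynomial in `n`. -/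
def HasPolynomialGrowth (S : Finset G) : Prop :=
  ∃ C d : ℕ, ∀ n : ℕ, (S ^ n).card ≤ C * (n + 1) ^ d

theorem HasPolynomialGrowth.mono {S T : Finset G} (hT : HasPolynomialGrowth T) (h : S ⊆ T) :
    HasPolynomialGrowth S := by
  obtain ⟨C, d, hC⟩ := hT
  exact ⟨C, d, fun n => (Finset.card_le_card (Finset.pow_subset_pow_left h)).trans (hC n)⟩

/-- If `m` iterated commutators with `s` kill `x`, then `s ^ k * x * s ^ (-k)` is a product of
polynomially many iterated commutators of `x` with `s`. -/
theorem conj_pow_mem_pow {s : G} {Q : Finset G} (hQ : 1 ∈ Q) (m : ℕ) :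
    ∀ x : G, (∀ i, (fun y => ⁅s, y⁆)^[i] x ∈ Q) → (fun y => ⁅s, y⁆)^[m] x = 1 →
      ∀ k : ℕ, s ^ k * x * (s ^ k)⁻¹ ∈ Q ^ (k + 1) ^ m := by
  induction m with
  | zero =>
    intro x _ hx k
    obtain rfl : x = 1 := hx
    simpa using hQ
  | succ m ih =>
    intro x hxQ hx K
    have key := ih ⁅s, x⁆ (fun i => hxQ (i + 1)) hx
    have aux : ∀ k ≤ K, s ^ k * x * (s ^ k)⁻¹ ∈ Q ^ (k * (K + 1) ^ m + 1) := by
      intro k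
      induction k with
      | zero => intro _; simpa using hxQ 0
      | succ k ihk =>
        intro hk
        have h₁ : s ^ k * ⁅s, x⁆ * (s ^ k)⁻¹ ∈ Q ^ (K + 1) ^ m :=
          Finset.pow_subset_pow_right hQ (Nat.pow_le_pow_left (by omega) m) (key k)
        have h₂ := Finset.mul_mem_mul h₁ (ihk (by omega))
        rw [← pow_add] at h₂
        convert h₂ using 1
        · ring_nf
        · rw [commutatorElement_def, pow_succ]; group
    refine Finset.pow_subset_pow_right hQ ?_ (aux K le_rfl)
    have : 1 ≤ (K + 1) ^ m := Nat.one_le_pow _ _ (by omega)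
    calc K * (K + 1) ^ m + 1 ≤ K * (K + 1) ^ m + (K + 1) ^ m := by omega
      _ = (K + 1) ^ (m + 1) := by ring

/-- Collecting all occurrences of `s` at the end of a word. -/
theorem exists_mul_pow_of_mem_insert_pow {s : G} {E Q : Finset G} (hQ : 1 ∈ Q) {m : ℕ}
    (h : ∀ x ∈ E, ∀ k : ℕ, s ^ k * x * (s ^ k)⁻¹ ∈ Q ^ (k + 1) ^ m) {N n : ℕ} (hn : n ≤ N)
    {w : G} (hw : w ∈ insert s E ^ n) :
    ∃ k ≤ n, ∃ u ∈ Q ^ (n * (N + 1) ^ m), w = u * s ^ k := by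
  induction n generalizing w with
  | zero => exact ⟨0, le_rfl, 1, by simp, by simpa using hw⟩
  | succ n ih =>
    rw [pow_succ, Finset.mem_mul] at hw
    obtain ⟨v, hv, x, hx, rfl⟩ := hw
    obtain ⟨k, hk, u, hu, rfl⟩ := ih (by omega) hv
    rcases Finset.mem_insert.1 hx with rfl | hx
    · exact ⟨k + 1, by omega, u,
        Finset.pow_subset_pow_right hQ (Nat.mul_le_mul_right _ n.le_succ) hu,
        by rw [pow_succ, mul_assoc]⟩
    · refine ⟨k, by omega, u * (s ^ k * x * (s ^ k)⁻¹), ?_, by group⟩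
      have h₁ := Finset.pow_subset_pow_right hQ
        (Nat.pow_le_pow_left (show k + 1 ≤ N + 1 by omega) m) (h x hx k)
      have h₂ := Finset.mul_mem_mul hu h₁
      rwa [← pow_add, ← Nat.succ_mul] at h₂

theorem HasPolynomialGrowth.insert_of_conj {s : G} {E Q : Finset G} (hQ : 1 ∈ Q) {m : ℕ}
    (h : ∀ x ∈ E, ∀ k : ℕ, s ^ k * x * (s ^ k)⁻¹ ∈ Q ^ (k + 1) ^ m)
    (hpoly : HasPolynomialGrowth Q) : HasPolynomialGrowth (insert s E) := by
  obtain ⟨C, d, hC⟩ := hpoly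
  refine ⟨C, (m + 1) * d + 1, fun n => ?_⟩
  have hsub : insert s E ^ n ⊆
      Q ^ (n * (n + 1) ^ m) * (Finset.range (n + 1)).image (fun k => s ^ k) := by
    intro w hw
    obtain ⟨k, hk, u, hu, rfl⟩ := exists_mul_pow_of_mem_insert_pow hQ h le_rfl hw
    exact Finset.mul_mem_mul hu
      (Finset.mem_image_of_mem _ (Finset.mem_range.2 (Nat.lt_succ_of_le hk)))
  have hle : n * (n + 1) ^ m + 1 ≤ (n + 1) ^ (m + 1) := by
    have : 1 ≤ (n + 1) ^ m := Nat.one_le_pow _ _ (by omega)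
    calc n * (n + 1) ^ m + 1 ≤ n * (n + 1) ^ m + (n + 1) ^ m := by omega
      _ = (n + 1) ^ (m + 1) := by ring
  calc (insert s E ^ n).card
      ≤ (Q ^ (n * (n + 1) ^ m)).card * ((Finset.range (n + 1)).image (fun k => s ^ k)).card :=
        (Finset.card_le_card hsub).trans Finset.card_mul_le
    _ ≤ (C * ((n + 1) ^ (m + 1)) ^ d) * (n + 1) := by
        gcongr
        · exact (hC _).trans (by gcongr)
        · simpa using Finset.card_image_le (s := Finset.range (n + 1)) (f := fun k => s ^ k)
    _ = C * (n + 1) ^ ((m + 1) * d + 1) := by rw [pow_succ _ ((m + 1) * d), pow_mul, mul_assoc]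

/-- Every finite subset of a nilpotent group has polynomial growth. -/
theorem hasPolynomialGrowth_of_isNilpotent [Group.IsNilpotent G] (S : Finset G) :
    HasPolynomialGrowth S := by
  obtain ⟨c, hc⟩ := Subgroup.nilpotent_iff_lowerCentralSeries.1 ‹Group.IsNilpotent G›
  have hbot : ∀ i, c ≤ i → (⊤ : Subgroup G).lowerCentralSeries i = ⊥ := fun i hi =>
    le_bot_iff.1 (hc ▸ Subgroup.lowerCentralSeries_antitone _ hi)
  suffices H : ∀ j i, c ≤ i + j → ∀ E : Finset G,
      (∀ x ∈ E, x ∈ (⊤ : Subgroup G).lowerCentralSeries i) → HasPolynomialGrowth E from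
    H c 0 (by omega) S fun x _ => Subgroup.mem_top x
  intro j
  induction j with
  | zero =>
    intro i hi E hE
    refine HasPolynomialGrowth.mono (T := 1) ⟨1, 0, fun n => by simp⟩ fun x hx => ?_
    have := hE x hx
    rw [hbot i hi, Subgroup.mem_bot] at this
    simp [this]
  | succ j ih =>
    intro i hi
    suffices H : ∀ E : Finset G, (∀ x ∈ E, x ∈ (⊤ : Subgroup G).lowerCentralSeries i) →
        ∀ T : Finset G, (∀ x ∈ T, x ∈ (⊤ : Subgroup G).lowerCentralSeries (i + 1)) →
          HasPolynomialGrowth (E ∪ T) from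
      fun E hE => by simpa using H E hE ∅ (by simp)
    intro E
    induction E using Finset.induction_on with
    | empty =>
      intro _ T hT
      simpa using ih (i + 1) (by omega) T hT
    | insert s E _ ihE =>
      intro hE T hT
      have hE' : ∀ x ∈ E, x ∈ (⊤ : Subgroup G).lowerCentralSeries i := fun x hx =>
        hE x (Finset.mem_insert_of_mem hx)
      have hET : ∀ x ∈ E ∪ T, x ∈ (⊤ : Subgroup G).lowerCentralSeries i := by
        intro x hx
        rcases Finset.mem_union.1 hx with hx | hx
        · exact hE' x hx
        · exact Subgroup.lowerCentralSeries_antitone _ i.le_succ (hT x hx)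
      have hone : ∀ x ∈ E ∪ T, ∀ l, c ≤ l → (fun y => ⁅s, y⁆)^[l] x = 1 := by
        intro x hx l hl
        have := iterate_commutator_mem_lowerCentralSeries s (hET x hx) l
        rwa [hbot _ (by omega), Subgroup.mem_bot] at this
      let T' : Finset G := insert 1 (T ∪ (E ∪ T).biUnion fun x =>
        (Finset.range c).image fun l => (fun y => ⁅s, y⁆)^[l + 1] x)
      have hT' : ∀ x ∈ T', x ∈ (⊤ : Subgroup G).lowerCentralSeries (i + 1) := by
        intro x hx
        simp only [T', Finset.mem_insert, Finset.mem_union (s := T), Finset.mem_biUnion,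
          Finset.mem_image] at hx
        rcases hx with rfl | hx | ⟨y, hy, l, -, rfl⟩
        · exact one_mem _
        · exact hT x hx
        · exact Subgroup.lowerCentralSeries_antitone _ (by omega)
            (iterate_commutator_mem_lowerCentralSeries s (hET y hy) (l + 1))
      have h1 : (1 : G) ∈ E ∪ T' := Finset.mem_union_right _ (Finset.mem_insert_self _ _)
      rw [Finset.insert_union]
      refine HasPolynomialGrowth.insert_of_conj (m := c) h1 (fun x hx k => ?_) (ihE hE' T' hT')
      refine conj_pow_mem_pow h1 c x (fun l => ?_) (hone x hx c le_rfl) k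
      rcases l with _ | l
      · rcases Finset.mem_union.1 hx with hx | hx
        · exact Finset.mem_union_left _ hx
        · exact Finset.mem_union_right _
            (Finset.mem_insert_of_mem (Finset.mem_union_left _ hx))
      · by_cases hl : l < c
        · exact Finset.mem_union_right _ (Finset.mem_insert_of_mem (Finset.mem_union_right _
            (Finset.mem_biUnion.2 ⟨x, hx, Finset.mem_image_of_mem _ (Finset.mem_range.2 hl)⟩)))
        · rw [hone x hx (l + 1) (by omega)]
          exact h1

end Growth

/-- A function of polynomial growth has the doubling property at some scale between `r` and a
polynomial in `r`. -/
theorem exists_doubling_scale {f : ℕ → ℕ} (hf : ∀ n, 1 ≤ f n) {C d : ℕ}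
    (hC : ∀ n, f n ≤ C * (n + 1) ^ d) :
    ∃ K M : ℕ, ∀ r, 1 ≤ r → ∃ R, r ≤ R ∧ R ≤ M * r ^ (d + 1) ∧ f (8 * R) ≤ K * f R := by
  refine ⟨8 ^ (d + 1), 8 * (C * 2 ^ d), fun r hr => ?_⟩
  have hCpos : C ≠ 0 := by
    rintro rfl
    have := (hf 0).trans (hC 0)
    simp at this
  set A := C * 2 ^ d * r ^ d with hA
  have hA0 : A ≠ 0 := by positivity
  obtain ⟨J, hJA, hAJ⟩ : ∃ J, A < 8 ^ J ∧ 8 ^ J ≤ 8 * A := by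
    refine ⟨Nat.log 8 A + 1, Nat.lt_pow_succ_log_self (by norm_num) A, ?_⟩
    rw [pow_succ, mul_comm]
    exact Nat.mul_le_mul_left _ (Nat.pow_log_le_self 8 hA0)
  by_contra! hcon
  have hgrow : ∀ j ≤ J, (8 ^ (d + 1)) ^ j ≤ f (8 ^ j * r) := by
    intro j
    induction j with
    | zero => intro _; simpa using hf r
    | succ j ih =>
      intro hj
      have hlow : r ≤ 8 ^ j * r := Nat.le_mul_of_pos_left _ (by positivity)
      have hup : 8 ^ j * r ≤ 8 * (C * 2 ^ d) * r ^ (d + 1) := by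
        calc 8 ^ j * r ≤ 8 ^ J * r := by
              gcongr
              · norm_num
              · omega
          _ ≤ 8 * A * r := by gcongr
          _ = _ := by rw [hA]; ring
      have := hcon _ hlow hup
      calc (8 ^ (d + 1)) ^ (j + 1) = 8 ^ (d + 1) * (8 ^ (d + 1)) ^ j := by ring
        _ ≤ 8 ^ (d + 1) * f (8 ^ j * r) := by gcongr; exact ih (by omega)
        _ ≤ f (8 * (8 ^ j * r)) := this.le
        _ = f (8 ^ (j + 1) * r) := by congr 1; ring
  have h₁ := (hgrow J le_rfl).trans (hC _)
  have h₂ : C * (8 ^ J * r + 1) ^ d ≤ A * (8 ^ J) ^ d := by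
    have : 1 ≤ 8 ^ J * r := Nat.mul_pos (by positivity) hr
    calc C * (8 ^ J * r + 1) ^ d ≤ C * (2 * (8 ^ J * r)) ^ d := by gcongr; omega
      _ = A * (8 ^ J) ^ d := by rw [hA]; ring
  have h₃ : (8 ^ (d + 1)) ^ J = 8 ^ J * (8 ^ J) ^ d := by
    rw [pow_succ, mul_pow, mul_comm, pow_right_comm]
  rw [h₃] at h₁
  have h₄ : A * (8 ^ J) ^ d < 8 ^ J * (8 ^ J) ^ d := by gcongr
  omega

/-- Greedy colouring of a symmetric locally finite relation. -/
theorem exists_greedy_coloring {X : Type*} (r : X → X → Prop) (hsymm : ∀ x y, r x y → r y x)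
    (hfin : ∀ x, {y | r x y}.Finite) :
    ∃ c : X → ℕ, (∀ x y, r x y → x ≠ y → c x ≠ c y) ∧
      ∀ x, ∀ m < c x, ∃ y, r x y ∧ c y = m := by
  have wf : WellFounded (WellOrderingRel (α := X)) := WellOrderingRel.isWellOrder.wf
  let c : X → ℕ := wf.fix fun x ih => sInf {m | ∀ y h, r x y → ih y h ≠ m}
  have hc : ∀ x, c x = sInf {m | ∀ y, WellOrderingRel y x → r x y → c y ≠ m} := fun x =>
    wf.fix_eq _ x
  have hlt : ∀ x y, WellOrderingRel y x → r x y → c y ≠ c x := by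
    intro x
    have hne : {m | ∀ y, WellOrderingRel y x → r x y → c y ≠ m}.Nonempty := by
      obtain ⟨m, hm⟩ := ((hfin x).image c).exists_notMem
      exact ⟨m, fun y _ hy h => hm ⟨y, hy, h⟩⟩
    have := Nat.sInf_mem hne
    rwa [← hc] at this
  refine ⟨c, fun x y hxy hne => ?_, fun x m hm => ?_⟩
  · rcases trichotomous_of WellOrderingRel x y with h | h | h
    · exact hlt y x h (hsymm x y hxy)
    · exact absurd h hne
    · exact (hlt x y h hxy).symm
  · rw [hc] at hm
    have := Nat.notMem_of_lt_sInf hm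
    simp only [Set.mem_ofPred_eq, not_forall, not_not] at this
    obtain ⟨y, _, hy, h⟩ := this
    exact ⟨y, hy, h⟩

section Covering

variable {X : Type*} {d : X → X → ℕ} {f : ℕ → ℕ} {B : X → ℕ → Finset X}

theorem card_mul_le_of_separated (hsymm : ∀ x y, d x y = d y x)
    (htri : ∀ x y z, d x z ≤ d x y + d y z) (hB : ∀ x n y, y ∈ B x n ↔ d x y ≤ n)
    (hf : ∀ x n, (B x n).card = f n) {R a : ℕ} (F : Finset X)
    (hF : ∀ z ∈ F, ∀ z' ∈ F, z ≠ z' → 2 * R < d z z') (x : X) (hx : ∀ z ∈ F, d x z ≤ a) :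
    F.card * f R ≤ f (a + R) := by
  classical
  have hdisj : (F : Set X).PairwiseDisjoint fun z => B z R := by
    intro z hz z' hz' hne
    refine Finset.disjoint_left.2 fun y hy hy' => ?_
    rw [hB] at hy hy'
    have h₁ := hF z hz z' hz' hne
    have h₂ := htri z y z'
    rw [hsymm y z'] at h₂
    omega
  calc F.card * f R = (F.biUnion fun z => B z R).card := by
        rw [Finset.card_biUnion hdisj, Finset.sum_congr rfl fun z _ => hf z R, Finset.sum_const,
          smul_eq_mul]
    _ ≤ (B x (a + R)).card := by
        refine Finset.card_le_card fun y hy => ?_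
        obtain ⟨z, hz, hy⟩ := Finset.mem_biUnion.1 hy
        rw [hB] at hy ⊢
        have h₁ := hx z hz
        have h₂ := htri x z y
        omega
    _ = f (a + R) := hf _ _

/-- Existence of maximal separated nets. -/
theorem exists_separated_net (hself : ∀ x, d x x = 0) (hsymm : ∀ x y, d x y = d y x)
    (hB : ∀ x n y, y ∈ B x n ↔ d x y ≤ n) (R : ℕ) :
    ∃ Z : Set X, (∀ z ∈ Z, ∀ z' ∈ Z, z ≠ z' → R < d z z') ∧ ∀ x, ∃ z ∈ Z, d z x ≤ R := by
  obtain ⟨c, hc, hgreedy⟩ := exists_greedy_coloring (fun x y => d x y ≤ R)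
    (fun x y h => by rwa [hsymm]) (fun x => (B x R).finite_toSet.subset fun y hy => (hB x R y).2 hy)
  refine ⟨{z | c z = 0}, fun z hz z' hz' hne => ?_, fun x => ?_⟩
  · by_contra! h
    exact hc z z' h hne (hz.trans hz'.symm)
  · rcases Nat.eq_zero_or_pos (c x) with h | h
    · exact ⟨x, h, by simp [hself]⟩
    · obtain ⟨y, hy, hy0⟩ := hgreedy x 0 h
      exact ⟨y, hy0, by rwa [hsymm]⟩

/-- At a scale where balls are doubling, there is a cover by balls with bounded multiplicity,
Lebesgue number at least `R` and diameter at most `6 * R`. -/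
theorem exists_cover_of_doubling [Nonempty X] (hself : ∀ x, d x x = 0)
    (hsymm : ∀ x y, d x y = d y x)
    (htri : ∀ x y z, d x z ≤ d x y + d y z) (hB : ∀ x n y, y ∈ B x n ↔ d x y ≤ n)
    (hf : ∀ x n, (B x n).card = f n) {R K : ℕ} (hRK : f (8 * R) ≤ K * f R) :
    ∃ 𝒰 : Set (Set X), IsCover 𝒰 ∧ IsLebesgueNumber (fun x y => (d x y : ℝ)) 𝒰 R ∧
      MultiplicityLE 𝒰 K ∧ FamilyDiamLE (fun x y => (d x y : ℝ)) 𝒰 (6 * R) := by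
  classical
  have hmono : Monotone f := fun m n hmn => by
    obtain ⟨x⟩ := ‹Nonempty X›
    rw [← hf x, ← hf x]
    exact Finset.card_le_card fun y hy => by rw [hB] at hy ⊢; omega
  have hpos : 0 < f R := by
    obtain ⟨x⟩ := ‹Nonempty X›
    rw [← hf x]
    exact Finset.card_pos.2 ⟨x, by simp [hB, hself]⟩
  obtain ⟨Z, hZ, hnet⟩ := exists_separated_net hself hsymm hB (2 * R)
  refine ⟨(fun z => (B z (3 * R) : Set X)) '' Z, fun x => ?_, fun A hA => ?_, fun F hF hx => ?_, ?_⟩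
  · obtain ⟨z, hz, hzx⟩ := hnet x
    refine ⟨_, ⟨z, hz, rfl⟩, ?_⟩
    rw [Finset.mem_coe, hB]
    omega
  · obtain ⟨x, hx⟩ : ∃ x, ∀ y ∈ A, d x y ≤ R := by
      rcases A.eq_empty_or_nonempty with rfl | ⟨x, hx⟩
      · exact ⟨Classical.arbitrary X, by simp⟩
      · exact ⟨x, fun y hy => Nat.cast_le.1 (hA x hx y hy)⟩
    obtain ⟨z, hz, hzx⟩ := hnet x
    refine ⟨_, ⟨z, hz, rfl⟩, fun y hy => ?_⟩
    rw [Finset.mem_coe, hB]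
    have h₁ := hx y hy
    have h₂ := htri z x y
    omega
  · obtain ⟨x, hx⟩ := hx
    obtain ⟨F', hF', rfl⟩ := Finset.subset_set_image_iff.1 hF
    refine Finset.card_image_le.trans (Nat.le_of_mul_le_mul_right ?_ hpos)
    refine (card_mul_le_of_separated hsymm htri hB hf F'
      (fun z hz z' hz' => hZ z (hF' hz) z' (hF' hz')) x (a := 3 * R) fun z hz => ?_).trans
      ((hmono (by omega)).trans hRK)
    have : x ∈ (B z (3 * R) : Set X) := hx _ (Finset.mem_coe.2 (Finset.mem_image_of_mem _ hz))
    rwa [Finset.mem_coe, hB, hsymm] at this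
  · rintro _ ⟨z, _, rfl⟩ x hx y hy
    rw [Finset.mem_coe, hB] at hx hy
    have := htri x z y
    rw [hsymm x z] at this
    have h : d x y ≤ 6 * R := by omega
    change (d x y : ℝ) ≤ 6 * R
    exact_mod_cast h

/-- At a scale where balls are doubling, there is a cover by boundedly many separated families
of balls. -/
theorem exists_separated_families_of_doubling [Nonempty X] (hself : ∀ x, d x x = 0)
    (hsymm : ∀ x y, d x y = d y x)
    (htri : ∀ x y z, d x z ≤ d x y + d y z) (hB : ∀ x n y, y ∈ B x n ↔ d x y ≤ n)
    (hf : ∀ x n, (B x n).card = f n) {R K : ℕ} (hRK : f (8 * R) ≤ K * f R) :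
    ∃ 𝒰 : Fin (K + 1) → Set (Set X),
      (∀ i, UniformlyBounded (fun x y => (d x y : ℝ)) (𝒰 i)) ∧
      (∀ i, ∀ U ∈ 𝒰 i, ∀ V ∈ 𝒰 i, U ≠ V → ∀ x ∈ U, ∀ y ∈ V, (R : ℝ) ≤ d x y) ∧
      IsCover (⋃ i, 𝒰 i) := by
  classical
  have hmono : Monotone f := fun m n hmn => by
    obtain ⟨x⟩ := ‹Nonempty X›
    rw [← hf x, ← hf x]
    exact Finset.card_le_card fun y hy => by rw [hB] at hy ⊢; omega
  have hpos : 0 < f R := by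
    obtain ⟨x⟩ := ‹Nonempty X›
    rw [← hf x]
    exact Finset.card_pos.2 ⟨x, by simp [hB, hself]⟩
  obtain ⟨Z, hZ, hnet⟩ := exists_separated_net hself hsymm hB (2 * R)
  obtain ⟨c, hc, hgreedy⟩ := exists_greedy_coloring
    (fun x y => y ∈ Z ∧ x ∈ Z ∧ d x y ≤ 5 * R)
    (fun x y h => ⟨h.2.1, h.1, by rw [hsymm]; exact h.2.2⟩)
    (fun x => (B x (5 * R)).finite_toSet.subset fun y hy => (hB x _ y).2 hy.2.2)
  have hcK : ∀ z, c z ≤ K := by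
    intro z
    choose! g hg hgc using hgreedy z
    have hinj : Set.InjOn g (Finset.range (c z)) := fun m hm m' hm' h => by
      rw [← hgc m (Finset.mem_range.1 hm), ← hgc m' (Finset.mem_range.1 hm'), h]
    rw [← Finset.card_range (c z), ← Finset.card_image_of_injOn hinj]
    refine Nat.le_of_mul_le_mul_right ?_ hpos
    refine (card_mul_le_of_separated hsymm htri hB hf _ (fun y hy y' hy' => ?_) z (a := 5 * R)
      fun y hy => ?_).trans ((hmono (by omega)).trans hRK)
    · obtain ⟨m, hm, rfl⟩ := Finset.mem_image.1 hy
      obtain ⟨m', hm', rfl⟩ := Finset.mem_image.1 hy'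
      exact hZ _ (hg m (Finset.mem_range.1 hm)).1 _ (hg m' (Finset.mem_range.1 hm')).1
    · obtain ⟨m, hm, rfl⟩ := Finset.mem_image.1 hy
      exact (hg m (Finset.mem_range.1 hm)).2.2
  refine ⟨fun i => (fun z => (B z (2 * R) : Set X)) '' {z ∈ Z | c z = i},
    fun i => ⟨4 * R, ?_⟩, ?_, fun x => ?_⟩
  · rintro _ ⟨z, _, rfl⟩ x hx y hy
    rw [Finset.mem_coe, hB] at hx hy
    have := htri x z y
    rw [hsymm x z] at this
    have h : d x y ≤ 4 * R := by omega
    change (d x y : ℝ) ≤ 4 * R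
    exact_mod_cast h
  · rintro i _ ⟨z, ⟨hz, hzi⟩, rfl⟩ _ ⟨z', ⟨hz', hzi'⟩, rfl⟩ hne x hx y hy
    rw [Finset.mem_coe, hB] at hx hy
    have hzz' : 5 * R < d z z' := by
      by_contra! h
      exact hc z z' ⟨hz', hz, h⟩ (by rintro rfl; exact hne rfl) (hzi.trans hzi'.symm)
    have h₁ := htri z x z'
    have h₂ := htri x y z'
    rw [hsymm y z'] at h₂
    have h : R ≤ d x y := by omega
    exact_mod_cast h
  · obtain ⟨z, hz, hzx⟩ := hnet x
    refine ⟨_, Set.mem_iUnion.2 ⟨⟨c z, Nat.lt_succ_of_le (hcK z)⟩, z, ⟨hz, rfl⟩, rfl⟩, ?_⟩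
    rwa [Finset.mem_coe, hB]

end Covering

section WordMetric

open scoped Pointwise

variable {G : Type*} [Group G] [DecidableEq G] {T : Finset G}

theorem wordNorm_le_iff (hone : 1 ∈ T) (hinv : ∀ t ∈ T, t⁻¹ ∈ T)
    (hgen : Subgroup.closure (T : Set G) = ⊤) {g : G} {n : ℕ} :
    wordNorm (T : Set G) g ≤ n ↔ g ∈ T ^ n := by
  have hlist : ∀ l : List G, (∀ s ∈ l, s ∈ T) → l.prod ∈ T ^ l.length := by
    intro l
    induction l with
    | nil => simp
    | cons a l ih =>
      intro h
      rw [List.prod_cons, List.length_cons, pow_succ']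
      exact Finset.mul_mem_mul (h a (by simp)) (ih fun s hs => h s (by simp [hs]))
  constructor
  · intro h
    have hmem : g ∈ Submonoid.closure (T : Set G) := by
      have hg : g ∈ (Subgroup.closure (T : Set G)).toSubmonoid := by simp [hgen]
      rw [Subgroup.closure_toSubmonoid] at hg
      rwa [Set.union_eq_left.2 fun x hx => by simpa using hinv _ (Set.mem_inv.1 hx)] at hg
    obtain ⟨l, hl, hlg⟩ := Submonoid.exists_list_of_mem_closure hmem
    obtain ⟨l', hl', rfl, hlen⟩ := Nat.sInf_mem
      (s := {n : ℕ | ∃ l : List G, (∀ s ∈ l, s ∈ (T : Set G)) ∧ l.prod = g ∧ l.length = n})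
      ⟨_, l, hl, hlg, rfl⟩
    refine Finset.pow_subset_pow_right hone ?_ (hlist l' hl')
    rw [hlen]
    exact h
  · intro h
    refine Nat.sInf_le ?_
    induction n generalizing g with
    | zero => exact ⟨[], by simp, by simpa [eq_comm] using h, rfl⟩
    | succ n ih =>
      rw [pow_succ', Finset.mem_mul] at h
      obtain ⟨a, ha, b, hb, rfl⟩ := h
      obtain ⟨l, hl, rfl, rfl⟩ := ih hb
      exact ⟨a :: l, by simpa using ⟨ha, hl⟩, by simp, rfl⟩

theorem inv_mem_pow_of_symmetric (hinv : ∀ t ∈ T, t⁻¹ ∈ T) {g : G} {n : ℕ} (hg : g ∈ T ^ n) :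
    g⁻¹ ∈ T ^ n := by
  have hT : T⁻¹ = T := by
    ext t
    exact ⟨fun h => by simpa using hinv _ (Finset.mem_inv'.1 h),
      fun h => Finset.mem_inv'.2 (hinv t h)⟩
  rwa [← Finset.mem_inv', ← inv_pow, hT]

/-- A group with a symmetric generating set of polynomial growth has finite asymptotic dimension
with polynomial control. -/
theorem HasPolynomialGrowth.asdimLE_and_gromovLE (hone : 1 ∈ T) (hinv : ∀ t ∈ T, t⁻¹ ∈ T)
    (hgen : Subgroup.closure (T : Set G) = ⊤) (hT : HasPolynomialGrowth T) :
    ∃ k : ℕ, AsdimLE (wordDist (T : Set G)) k ∧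
      ∃ P : Polynomial ℝ, GromovLE (wordDist (T : Set G)) k P.eval := by
  obtain ⟨C, e, hC⟩ := hT
  obtain ⟨K, M, hKM⟩ := exists_doubling_scale (f := fun n => (T ^ n).card)
    (fun n => Finset.card_pos.2 ⟨1, Finset.one_mem_pow hone⟩) hC
  let d : G → G → ℕ := fun x y => wordNorm (T : Set G) (x⁻¹ * y)
  have hd : ∀ {x y n}, d x y ≤ n ↔ x⁻¹ * y ∈ T ^ n := wordNorm_le_iff hone hinv hgen
  have hself : ∀ x, d x x = 0 := fun x => Nat.le_zero.1 (hd.2 (by simp))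
  have hle : ∀ x y, d x y ≤ d y x := fun x y => hd.2 <| by
    simpa using inv_mem_pow_of_symmetric hinv (hd.1 (le_refl (d y x)))
  have hsymm : ∀ x y, d x y = d y x := fun x y => (hle x y).antisymm (hle y x)
  have htri : ∀ x y z, d x z ≤ d x y + d y z := fun x y z => hd.2 <| by
    simpa [pow_add, mul_assoc] using
      Finset.mul_mem_mul (hd.1 (le_refl (d x y))) (hd.1 (le_refl (d y z)))
  let B : G → ℕ → Finset G := fun x n => (T ^ n).image (x * ·)
  have hB : ∀ x n y, y ∈ B x n ↔ d x y ≤ n := by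
    intro x n y
    rw [hd, Finset.mem_image]
    exact ⟨by rintro ⟨g, hg, rfl⟩; simpa using hg, fun h => ⟨_, h, by simp⟩⟩
  have hf : ∀ x n, (B x n).card = (T ^ n).card := fun x n =>
    Finset.card_image_of_injective _ (mul_right_injective x)
  refine ⟨K, fun r => ?_, Polynomial.C (6 * M : ℝ) * (Polynomial.X + 1) ^ (e + 1),
    fun lam hlam => ?_⟩
  · obtain ⟨R, hrR, -, hR⟩ := hKM (⌈r⌉₊ + 1) (by omega)
    obtain ⟨𝒰, hbdd, hsep, hcov⟩ :=
      exists_separated_families_of_doubling (f := fun n => (T ^ n).card) hself hsymm htri hB hf hR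
    refine ⟨𝒰, hbdd, fun i U hU V hV hne x hx y hy => ?_, hcov⟩
    have : (⌈r⌉₊ : ℝ) ≤ R := by exact_mod_cast (Nat.le_succ _).trans hrR
    exact (Nat.le_ceil r).trans (this.trans (hsep i U hU V hV hne x hx y hy))
  · obtain ⟨R, hrR, hRM, hR⟩ := hKM ⌈lam⌉₊ (Nat.one_le_iff_ne_zero.2 (Nat.ceil_pos.2 hlam).ne')
    obtain ⟨𝒰, hcov, hleb, hmult, hdiam⟩ :=
      exists_cover_of_doubling (f := fun n => (T ^ n).card) hself hsymm htri hB hf hR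
    refine ⟨𝒰, hcov, fun A hA => hleb A fun x hx y hy => (hA x hx y hy).trans ?_,
      fun F hF hx => (hmult F hF hx).trans K.le_succ,
      fun U hU x hx y hy => (hdiam U hU x hx y hy).trans ?_⟩
    · exact (Nat.le_ceil lam).trans (by exact_mod_cast hrR)
    · have h₁ : (R : ℝ) ≤ M * (⌈lam⌉₊ : ℝ) ^ (e + 1) := by exact_mod_cast hRM
      have h₂ : (⌈lam⌉₊ : ℝ) ^ (e + 1) ≤ (lam + 1) ^ (e + 1) := by
        gcongr
        exact (Nat.ceil_lt_add_one hlam.le).le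
      simp only [Polynomial.eval_mul, Polynomial.eval_C, Polynomial.eval_pow, Polynomial.eval_add,
        Polynomial.eval_X, Polynomial.eval_one]
      calc (6 * R : ℝ) ≤ 6 * (M * (lam + 1) ^ (e + 1)) := by gcongr; exact h₁.trans (by gcongr)
        _ = 6 * M * (lam + 1) ^ (e + 1) := by ring

end WordMetric

/-- For every finitely generated nilpotent group `N` there is `k ∈ ℕ`
such that `asdim N ≤ k` and Gromov's function `γ_N` for this inequality, taken with
respect to a word metric on `N`, is bounded above by a polynomial. -/
theorem statement17 (N : Type*) [Group N] [Group.IsNilpotent N] (hFG : Group.FG N) :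
    ∃ k : ℕ, ∃ T : Set N, T.Finite ∧ (∀ t ∈ T, t⁻¹ ∈ T) ∧ Subgroup.closure T = ⊤ ∧
      AsdimLE (wordDist T) k ∧
      ∃ P : Polynomial ℝ, GromovLE (wordDist T) k P.eval := by
  classical
  obtain ⟨S, hS⟩ := hFG.out
  let T : Finset N := insert 1 (S ∪ S.image (·⁻¹))
  have hinv : ∀ t ∈ T, t⁻¹ ∈ T := by
    intro t ht
    simp only [T, Finset.mem_insert, Finset.mem_union, Finset.mem_image, inv_eq_one] at ht ⊢
    rcases ht with ht | ht | ⟨s, hs, rfl⟩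
    · exact Or.inl ht
    · exact Or.inr (Or.inr ⟨t, ht, rfl⟩)
    · exact Or.inr (Or.inl (by rwa [inv_inv]))
  have hgen : Subgroup.closure (T : Set N) = ⊤ := by
    refine top_le_iff.1 (hS ▸ Subgroup.closure_mono fun x hx => ?_)
    simp only [T, Finset.coe_insert, Finset.coe_union, Set.mem_insert_iff, Set.mem_union]
    exact Or.inr (Or.inl hx)
  obtain ⟨k, hasdim, hgromov⟩ :=
    (hasPolynomialGrowth_of_isNilpotent T).asdimLE_and_gromovLE (Finset.mem_insert_self _ _)
      hinv hgen
  exact ⟨k, T, T.finite_toSet, hinv, hgen, hasdim, hgromov⟩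
end
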